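/- Let X_1 ⊆ ℝ^{n_1} and X_2 ⊆ ℝ^{n_2} be semialgebraic sets, with X_i closed in an open semialgebraic set U_i ⊆ ℝ^{n_i} (i = 1, 2). Let φ : X_1 → X_2 be a bijection such that φ = g_1|_{X_1} for a Nash map g_1 : U_1 → ℝ^{n_2} and φ^{-1} = g_2|_{X_2} for a Nash map g_2 : U_2 → ℝ^{n_1}. Then the pullback f ↦ f ∘ φ maps 𝓢_{U_2}(X_2) bijectively onto 𝓢_{U_1}(X_1), i.e. {f ∘ φ : f ∈ 𝓢_{U_2}(X_2)} = 𝓢_{U_1}(X_1). -/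

import Mathlib

/-- A set `S ⊆ ℝⁿ` is semialgebraic if it is a finite union of sets of the form
`{x | p(x) = 0, q₁(x) > 0, …, q_r(x) > 0}` for real polynomials. -/
def IsSemialgebraic {n : ℕ} (S : Set (Fin n → ℝ)) : Prop :=
  ∃ (m : ℕ) (p : Fin m → MvPolynomial (Fin n) ℝ)
    (Q : Fin m → Finset (MvPolynomial (Fin n) ℝ)),
    S = ⋃ i, {x | MvPolynomial.eval x (p i) = 0 ∧ ∀ q ∈ Q i, 0 < MvPolynomial.eval x q}

/-- A Nash map on an open semialgebraic set `U ⊆ ℝⁿ` is a `C^∞` map `g : U → ℝ^m`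
whose graph is a semialgebraic subset of `ℝ^{n+m}`. -/
def IsNashMap {n m : ℕ} (U : Set (Fin n → ℝ)) (g : (Fin n → ℝ) → (Fin m → ℝ)) : Prop :=
  ContDiffOn ℝ (⊤ : ℕ∞) g U ∧
    IsSemialgebraic {p : Fin (n + m) → ℝ |
      (fun i => p (Fin.castAdd m i)) ∈ U ∧
      ∀ j, g (fun i => p (Fin.castAdd m i)) j = p (Fin.natAdd n j)}

/-- A smooth function is flat at `z` if all its iterated derivatives (including the
value, `k = 0`) vanish at `z`. -/
def SmoothFlatAt {n : ℕ} (φ : (Fin n → ℝ) → ℝ) (z : Fin n → ℝ) : Prop :=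
  ∀ k : ℕ, iteratedFDeriv ℝ k φ z = 0

/-- For `W ⊆ ℝⁿ` open semialgebraic and `V ⊆ W` closed in `W`, the space
`𝓢_W(V) := {φ|_V : φ ∈ 𝓢(ℝⁿ), φ flat on ℝⁿ \ W}`. -/
def SchwartzRelOpen {n : ℕ} (W V : Set (Fin n → ℝ)) : Set (↥V → ℝ) :=
  {f | ∃ φ : SchwartzMap ((Fin n) → ℝ) ℝ,
        (∀ z ∈ Wᶜ, SmoothFlatAt (⇑φ) z) ∧ ∀ v : ↥V, f v = φ v}

section part1
open Polynomial

/-- order isomorphism of the line supported in `(a,b)` moving one point to another -/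
theorem exists_orderIso_move (a b c c' : ℝ) (hac : a < c) (hcb : c < b) (hac' : a < c')
    (hcb' : c' < b) : ∃ k : ℝ ≃o ℝ, k c = c' ∧ (∀ t, t ≤ a → k t = t) ∧ (∀ t, b ≤ t → k t = t) := by
  classical
  let f : ℝ → ℝ → ℝ → ℝ := fun c c' t =>
    if t ≤ a then t else if b ≤ t then t else
      if t ≤ c then a + (t - a) * ((c' - a) / (c - a)) else b - (b - t) * ((b - c') / (b - c))
  have key : ∀ c c', a < c → c < b → a < c' → c' < b → ∀ t, f c' c (f c c' t) = t := by
    intro c c' h1 h2 h3 h4 t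
    by_cases ha : t ≤ a
    · simp [f, ha]
    by_cases hb : b ≤ t
    · simp [f, ha, hb]
    push Not at ha hb
    by_cases hc : t ≤ c
    · have e : f c c' t = a + (t - a) * ((c' - a) / (c - a)) := by
        simp [f, ha.not_ge, hb.not_ge, hc]
      have p1 : 0 < (t - a) * ((c' - a) / (c - a)) :=
        mul_pos (by linarith) (div_pos (by linarith) (by linarith))
      have p2 : (t - a) * ((c' - a) / (c - a)) ≤ c' - a := by
        rw [← mul_div_assoc, div_le_iff₀ (by linarith)]
        nlinarith
      rw [e]
      have q1 : ¬ (a + (t - a) * ((c' - a) / (c - a)) ≤ a) := by linarith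
      have q2 : ¬ (b ≤ a + (t - a) * ((c' - a) / (c - a))) := by linarith
      have q3 : (a + (t - a) * ((c' - a) / (c - a)) ≤ c') := by linarith
      simp only [f, q1, q2, q3, if_true, if_false]
      have : c - a ≠ 0 := by linarith
      have : c' - a ≠ 0 := by linarith
      field_simp
      ring
    · have e : f c c' t = b - (b - t) * ((b - c') / (b - c)) := by
        simp [f, ha.not_ge, hb.not_ge, hc]
      push Not at hc
      have p1 : 0 < (b - t) * ((b - c') / (b - c)) :=
        mul_pos (by linarith) (div_pos (by linarith) (by linarith))
      have p2 : (b - t) * ((b - c') / (b - c)) < b - c' := by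
        rw [← mul_div_assoc, div_lt_iff₀ (by linarith)]
        nlinarith
      rw [e]
      have q1 : ¬ (b - (b - t) * ((b - c') / (b - c)) ≤ a) := by linarith
      have q2 : ¬ (b ≤ b - (b - t) * ((b - c') / (b - c))) := by linarith
      have q3 : ¬ (b - (b - t) * ((b - c') / (b - c)) ≤ c') := by linarith
      simp only [f, q1, q2, q3, if_false]
      have : b - c ≠ 0 := by linarith
      have : b - c' ≠ 0 := by linarith
      field_simp
      ring
  have mono : Monotone (f c c') := by
    have hp : 0 < (c' - a) / (c - a) := div_pos (by linarith) (by linarith)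
    have hq : 0 < (b - c') / (b - c) := div_pos (by linarith) (by linarith)
    have hp' : (c' - a) / (c - a) * (c - a) = c' - a := div_mul_cancel₀ _ (by linarith)
    have hq' : (b - c') / (b - c) * (b - c) = b - c' := div_mul_cancel₀ _ (by linarith)
    generalize hP : (c' - a) / (c - a) = P at *
    generalize hQ : (b - c') / (b - c) = Q at *
    intro s t hst
    simp only [f, hP, hQ]
    split_ifs <;> nlinarith
  have smono : StrictMono (f c c') :=
    mono.strictMono_of_injective
      (Function.LeftInverse.injective (g := f c' c) (key c c' hac hcb hac' hcb'))
  have surj : Function.Surjective (f c c') :=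
    Function.RightInverse.surjective (g := f c' c) (key c' c hac' hcb' hac hcb)
  refine ⟨smono.orderIsoOfSurjective _ surj, ?_, ?_, ?_⟩
  · simp only [StrictMono.coe_orderIsoOfSurjective]
    simp only [f, hac.not_ge, hcb.not_ge, le_refl, if_true, if_false]
    have : c - a ≠ 0 := by linarith
    field_simp
    ring
  · intro t ht
    simp [f, ht]
  · intro t ht
    simp [f, ht]

/-- pseudo-division -/
theorem exists_pseudo_rem {A : Type*} [CommRing A] (q : A[X]) (hq : 1 ≤ q.natDegree) :
    ∀ (n : ℕ) (p : A[X]), p.natDegree ≤ n → ∃ (m : ℕ) (r s : A[X]), r.natDegree < q.natDegree ∧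
      C (q.leadingCoeff ^ m) * p = s * q + r := by
  intro n
  induction n with
  | zero =>
    intro p hp
    exact ⟨0, p, 0, by omega, by simp⟩
  | succ n ih =>
    intro p hp
    by_cases hlt : p.natDegree < q.natDegree
    · exact ⟨0, p, 0, hlt, by simp⟩
    · push Not at hlt
      set p1 := C q.leadingCoeff * p - C p.leadingCoeff * X ^ (p.natDegree - q.natDegree) * q with hp1
      have hdeg : p1.natDegree ≤ n := by
        have h0 : p1.natDegree ≤ p.natDegree := by
          refine (natDegree_sub_le _ _).trans (max_le (natDegree_C_mul_le _ _) ?_)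
          refine natDegree_mul_le.trans ?_
          have := natDegree_C_mul_X_pow_le p.leadingCoeff (p.natDegree - q.natDegree)
          omega
        have h1 : p1.coeff p.natDegree = 0 := by
          have h2 : p.natDegree = q.natDegree + (p.natDegree - q.natDegree) := by omega
          have h4 := coeff_mul_X_pow q (p.natDegree - q.natDegree) q.natDegree
          rw [← h2] at h4
          rw [hp1, coeff_sub, coeff_C_mul, mul_assoc, coeff_C_mul, X_pow_mul, h4]
          simp only [leadingCoeff]; ring
        have h3 : p.natDegree ≠ 0 := by omega
        have : p1.natDegree ≠ p.natDegree := by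
          intro h
          rw [← h, coeff_natDegree, leadingCoeff_eq_zero] at h1
          rw [h1] at h; simp at h; omega
        omega
      obtain ⟨m, r, s, hr, hs⟩ := ih p1 hdeg
      refine ⟨m + 1, r, s + C (q.leadingCoeff ^ m) * (C p.leadingCoeff * X ^ (p.natDegree - q.natDegree)), hr, ?_⟩
      rw [hp1] at hs
      rw [pow_succ, C_mul]
      linear_combination hs
end part1

section part2
open Polynomial

/-- `s` and `t` have the same position with respect to `Z`. -/
def SamePos (Z : Finset ℝ) (s t : ℝ) : Prop := ∀ z ∈ Z, (z < s ↔ z < t) ∧ (s < z ↔ t < z)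

theorem SamePos.symm {Z : Finset ℝ} {s t : ℝ} (h : SamePos Z s t) : SamePos Z t s :=
  fun z hz => ⟨(h z hz).1.symm, (h z hz).2.symm⟩

theorem SamePos.refl (Z : Finset ℝ) (s : ℝ) : SamePos Z s s := fun _ _ => ⟨Iff.rfl, Iff.rfl⟩

theorem SamePos.trans {Z : Finset ℝ} {r s t : ℝ} (h : SamePos Z r s) (h' : SamePos Z s t) :
    SamePos Z r t :=
  fun z hz => ⟨(h z hz).1.trans (h' z hz).1, (h z hz).2.trans (h' z hz).2⟩

theorem SamePos.notMem {Z : Finset ℝ} {s t : ℝ} (h : SamePos Z s t) (hs : s ∉ Z) : t ∉ Z := by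
  intro ht
  have := h t ht
  simp only [lt_irrefl, iff_false, not_lt] at this
  exact hs (le_antisymm this.1 this.2 ▸ ht)

theorem SamePos.between {Z : Finset ℝ} {s t x : ℝ} (h : SamePos Z s t) (hx : s ≤ x) (hx' : x ≤ t) :
    SamePos Z s x := by
  intro z hz
  have := h z hz
  constructor
  · constructor
    · intro h1; linarith
    · intro h1
      by_contra h2
      have := this.1.2 (by linarith)
      linarith
  · constructor
    · intro h1
      have := this.2.1 h1
      linarith
    · intro h1; linarith

theorem sign_const_of_ne {f : ℝ → ℝ} (hf : Continuous f) {s t : ℝ}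
    (h : ∀ x ∈ Set.uIcc s t, f x ≠ 0) : SignType.sign (f s) = SignType.sign (f t) := by
  by_contra hne
  have h0 : (0 : ℝ) ∈ Set.uIcc (f s) (f t) := by
    have hs := h s Set.left_mem_uIcc
    have ht := h t Set.right_mem_uIcc
    rw [Set.mem_uIcc]
    rcases lt_or_gt_of_ne hs with a | a <;> rcases lt_or_gt_of_ne ht with b | b
    · simp [sign_neg a, sign_neg b] at hne
    · left; constructor <;> linarith
    · right; constructor <;> linarith
    · simp [sign_pos a, sign_pos b] at hne
  obtain ⟨x, hx, hx0⟩ := intermediate_value_uIcc hf.continuousOn h0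
  exact h x hx hx0

theorem SamePos.between' {Z : Finset ℝ} {s t x : ℝ} (h : SamePos Z s t) (hx : x ∈ Set.uIcc s t) :
    SamePos Z s x := by
  rcases Set.mem_uIcc.1 hx with h1 | h1
  · exact h.between h1.1 h1.2
  · exact h.trans (h.symm.between h1.1 h1.2)

theorem SamePos.sign_eq {Z : Finset ℝ} {s t : ℝ} (h : SamePos Z s t) (hs : s ∉ Z) {f : ℝ → ℝ}
    (hf : Continuous f) (hZ : ∀ x, x ∉ Z → f x ≠ 0) :
    SignType.sign (f s) = SignType.sign (f t) :=
  sign_const_of_ne hf fun x hx => hZ x ((h.between' hx).notMem hs)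

theorem poly_mvt (P : ℝ[X]) {s t : ℝ} (hst : s < t) :
    ∃ x, s < x ∧ x < t ∧ P.eval t - P.eval s = P.derivative.eval x * (t - s) := by
  obtain ⟨x, hx, h⟩ := exists_deriv_eq_slope (fun x => P.eval x) hst P.continuous.continuousOn
    P.differentiable.differentiableOn
  refine ⟨x, hx.1, hx.2, ?_⟩
  rw [Polynomial.deriv] at h
  rw [h, div_mul_cancel₀ _ (by linarith)]

theorem poly_mono {Z : Finset ℝ} {P : ℝ[X]} (hZ : ∀ x, x ∉ Z → P.derivative.eval x ≠ 0)
    {c s t : ℝ} (hc : c ∉ Z) (hs : SamePos Z c s) (ht : SamePos Z c t)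
    (hpos : 0 < P.derivative.eval c) (hst : s < t) : P.eval s < P.eval t := by
  obtain ⟨x, h1, h2, h3⟩ := poly_mvt P hst
  have hx : SamePos Z c x := hs.trans ((hs.symm.trans ht).between h1.le h2.le)
  have := hx.sign_eq hc P.derivative.continuous hZ
  rw [sign_pos hpos, eq_comm, sign_eq_one_iff] at this
  nlinarith [mul_pos this (sub_pos.2 hst)]

theorem poly_unbdd {Z : Finset ℝ} {P : ℝ[X]} (hZ : ∀ x, x ∉ Z → P.derivative.eval x ≠ 0)
    {c : ℝ} (hc : ∀ z ∈ Z, z < c) (hpos : 0 < P.derivative.eval c) : ∃ b, c < b ∧ 0 < P.eval b := by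
  have hdeg : 0 < P.degree := by
    by_contra h
    push Not at h
    rw [eq_C_of_degree_le_zero h] at hpos
    simp at hpos
  have := (P.abs_tendsto_atTop hdeg).eventually_gt_atTop |P.eval c|
  obtain ⟨b, hb, hb'⟩ := (this.and (Filter.eventually_gt_atTop c)).exists
  refine ⟨b, hb', ?_⟩
  have hcZ : c ∉ Z := fun h => lt_irrefl _ (hc c h)
  have h1 : P.eval c < P.eval b := by
    refine poly_mono hZ hcZ (SamePos.refl _ _) ?_ hpos hb'
    intro z hz
    have := hc z hz
    constructor <;> constructor <;> intro h <;> linarith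
  by_contra h2
  push Not at h2
  rw [abs_of_nonpos h2] at hb
  have := neg_le_abs (P.eval c)
  linarith

section Step
variable (Z : Finset ℝ) (P Q : ℝ[X]) (h : ℝ ≃o ℝ)

/-- hypotheses of the step -/
structure StepHyp : Prop where
  ne : ∀ t, t ∉ Z → P.derivative.eval t ≠ 0
  der : ∀ t, SignType.sign (P.derivative.eval t) = SignType.sign (Q.derivative.eval (h t))
  val : ∀ z ∈ Z, SignType.sign (P.eval z) = SignType.sign (Q.eval (h z))

variable {Z P Q h}

theorem StepHyp.symm (H : StepHyp Z P Q h) : StepHyp (Z.map h.toEmbedding) Q P h.symm where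
  ne := by
    intro t ht hq
    have h1 := H.der (h.symm t)
    rw [OrderIso.apply_symm_apply, hq, sign_zero, sign_eq_zero_iff] at h1
    refine H.ne _ (fun h2 => ht ?_) h1
    rw [Finset.mem_map]
    exact ⟨_, h2, by simp⟩
  der := by
    intro t
    have h1 := H.der (h.symm t)
    rw [OrderIso.apply_symm_apply] at h1
    exact h1.symm
  val := by
    intro z hz
    obtain ⟨x, hx, rfl⟩ := Finset.mem_map.1 hz
    simpa using (H.val x hx).symm

theorem samePos_map_iff (h : ℝ ≃o ℝ) {s t : ℝ} :
    SamePos (Z.map h.toEmbedding) (h s) (h t) ↔ SamePos Z s t := by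
  constructor
  · intro H z hz
    have := H (h z) (Finset.mem_map.2 ⟨z, hz, rfl⟩)
    simpa using this
  · intro H z hz
    obtain ⟨x, hx, rfl⟩ := Finset.mem_map.1 hz
    simpa using H x hx

theorem StepHyp.basic (H : StepHyp Z P Q h) {t : ℝ} (ht : t ∉ Z) (hpos : 0 < P.derivative.eval t)
    (hlt : SignType.sign (Q.eval (h t)) < SignType.sign (P.eval t)) :
    ∃ t', SamePos Z t t' ∧ SignType.sign (Q.eval (h t')) = SignType.sign (P.eval t) := by
  have hcont : Continuous fun x => Q.eval (h x) := Q.continuous.comp h.continuous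
  have hQpos : 0 < Q.derivative.eval (h t) := by
    have := H.der t
    rwa [sign_pos hpos, eq_comm, sign_eq_one_iff] at this
  have hP0 : 0 ≤ P.eval t := by
    by_contra h1
    push Not at h1
    rw [sign_neg h1] at hlt
    exact absurd hlt (by cases SignType.sign (Q.eval (h t)) <;> decide)
  have hQ0 : Q.eval (h t) ≤ 0 := by
    by_contra h1
    push Not at h1
    rw [sign_pos h1] at hlt
    exact absurd hlt (by cases SignType.sign (P.eval t) <;> decide)
  obtain ⟨b, htb, hQb, hZb⟩ : ∃ b, t < b ∧ 0 < Q.eval (h b) ∧ ∀ z ∈ Z, t < z → b ≤ z := by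
    by_cases hne : (Z.filter (fun z => t < z)).Nonempty
    · set b := (Z.filter (fun z => t < z)).min' hne with hb
      have hbmem : b ∈ Z.filter (fun z => t < z) := Finset.min'_mem _ _
      have hbm : ∀ z ∈ Z, t < z → b ≤ z := fun z hz hz' =>
        Finset.min'_le _ _ (Finset.mem_filter.2 ⟨hz, hz'⟩)
      rw [Finset.mem_filter] at hbmem
      refine ⟨b, hbmem.2, ?_, hbm⟩
      have h1 := H.val b hbmem.1
      have h2 : 0 < P.eval b := by
        obtain ⟨x, hx1, hx2, hx3⟩ := poly_mvt P hbmem.2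
        have hx : SamePos Z t x := by
          intro z hz
          have hzt : z ≠ t := fun h => ht (h ▸ hz)
          rcases lt_or_gt_of_ne hzt with h5 | h5
          · constructor <;> constructor <;> intro h <;> linarith
          · have := hbm z hz h5
            constructor <;> constructor <;> intro h <;> linarith
        have := hx.sign_eq ht P.derivative.continuous H.ne
        rw [sign_pos hpos, eq_comm, sign_eq_one_iff] at this
        nlinarith [mul_pos this (sub_pos.2 hbmem.2)]
      rwa [sign_pos h2, eq_comm, sign_eq_one_iff] at h1
    · have hall : ∀ z ∈ Z, z < t := by
        intro z hz
        by_contra h1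
        push Not at h1
        exact hne ⟨z, Finset.mem_filter.2 ⟨hz, lt_of_le_of_ne h1 (fun h => ht (h ▸ hz))⟩⟩
      obtain ⟨b, hb, hb'⟩ := poly_unbdd H.symm.ne (c := h t) (by
        intro z hz
        obtain ⟨x, hx, rfl⟩ := Finset.mem_map.1 hz
        simpa using hall x hx) hQpos
      refine ⟨h.symm b, by rwa [OrderIso.lt_symm_apply], by simpa using hb', ?_⟩
      intro z hz hz'
      exact absurd (hall z hz) (by linarith)
  obtain ⟨v, hv1, hv2, hv3⟩ : ∃ v : ℝ, Q.eval (h t) ≤ v ∧ v < Q.eval (h b) ∧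
      SignType.sign v = SignType.sign (P.eval t) := by
    rcases hP0.eq_or_lt with h1 | h1
    · exact ⟨0, hQ0, hQb, by rw [← h1]⟩
    · exact ⟨Q.eval (h b) / 2, by linarith, by linarith, by rw [sign_pos h1, sign_pos (by linarith)]⟩
  obtain ⟨t', ht', hv'⟩ := intermediate_value_Ico htb.le hcont.continuousOn ⟨hv1, hv2⟩
  refine ⟨t', ?_, by rw [← hv3, ← hv']⟩
  intro z hz
  have hzt : z ≠ t := fun h => ht (h ▸ hz)
  rcases lt_or_gt_of_ne hzt with h5 | h5
  · constructor <;> constructor <;> intro h <;> linarith [ht'.1, ht'.2]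
  · have := hZb z hz h5
    constructor <;> constructor <;> intro h <;> linarith [ht'.1, ht'.2]

theorem StepHyp.neg (H : StepHyp Z P Q h) : StepHyp Z (-P) (-Q) h where
  ne := by intro t ht; simpa using H.ne t ht
  der := by intro t; simp [Left.sign_neg, H.der t]
  val := by intro z hz; simp [Left.sign_neg, H.val z hz]

/-- reflected order isomorphism -/
noncomputable def reflIso (h : ℝ ≃o ℝ) : ℝ ≃o ℝ where
  toFun t := - h (-t)
  invFun t := - h.symm (-t)
  left_inv t := by simp
  right_inv t := by simp
  map_rel_iff' := by intro a b; simp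

theorem reflIso_apply (h : ℝ ≃o ℝ) (t : ℝ) : reflIso h t = - h (-t) := rfl

theorem StepHyp.refl' (H : StepHyp Z P Q h) :
    StepHyp (Z.image (fun z => -z)) (-(P.comp (-X))) (-(Q.comp (-X))) (reflIso h) where
  ne := by
    intro t ht
    have := H.ne (-t) (fun h1 => ht (Finset.mem_image.2 ⟨-t, h1, neg_neg t⟩))
    simpa [derivative_comp] using this
  der := by
    intro t
    have := H.der (-t)
    simpa [derivative_comp, reflIso_apply] using this
  val := by
    intro z hz
    obtain ⟨x, hx, rfl⟩ := Finset.mem_image.1 hz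
    simpa [reflIso_apply, Left.sign_neg] using H.val x hx

theorem StepHyp.pos (H : StepHyp Z P Q h) {t : ℝ} (ht : t ∉ Z) (hpos : 0 < P.derivative.eval t) :
    ∃ t', SamePos Z t t' ∧ SignType.sign (Q.eval (h t')) = SignType.sign (P.eval t) := by
  rcases lt_trichotomy (SignType.sign (Q.eval (h t))) (SignType.sign (P.eval t)) with hl | he | hg
  · exact H.basic ht hpos hl
  · exact ⟨t, SamePos.refl _ _, he⟩
  · obtain ⟨t', h1, h2⟩ := H.refl'.basic (t := -t) (by simpa using ht)
      (by simpa [derivative_comp] using hpos) (by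
        simp only [reflIso_apply, eval_neg, eval_comp, eval_X, neg_neg, Left.sign_neg]
        revert hg
        generalize SignType.sign (Q.eval (h t)) = a
        generalize SignType.sign (P.eval t) = b
        revert a b; decide)
    refine ⟨-t', ?_, ?_⟩
    · intro z hz
      have := h1 (-z) (by simpa using hz)
      rw [neg_lt_neg_iff, neg_lt_neg_iff] at this
      rw [lt_neg, neg_lt]
      exact ⟨this.2.trans Iff.rfl, this.1⟩
    · simpa [reflIso_apply, Left.sign_neg] using h2

theorem StepHyp.exists_sign (H : StepHyp Z P Q h) {t : ℝ} (ht : t ∉ Z) :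
    ∃ t', SamePos Z t t' ∧ SignType.sign (Q.eval (h t')) = SignType.sign (P.eval t) := by
  rcases lt_or_gt_of_ne (H.ne t ht) with h1 | h1
  · obtain ⟨t', h2, h3⟩ := H.neg.pos ht (by simpa using h1)
    exact ⟨t', h2, by simpa [Left.sign_neg] using h3⟩
  · exact H.pos ht h1

end Step
end part2

section part3
open Polynomial

theorem samePos_of_fix {Z : Finset ℝ} {u : ℝ ≃o ℝ} (hu : ∀ z ∈ Z, u z = z) (t : ℝ) :
    SamePos Z t (u t) := by
  intro z hz
  constructor
  · conv_rhs => rw [← hu z hz]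
    exact (u.lt_iff_lt).symm
  · conv_rhs => rw [← hu z hz]
    exact (u.lt_iff_lt).symm

theorem exists_gap (W : Finset ℝ) (m M : ℝ) (hW : ∀ w ∈ W, w < m ∨ M < w) :
    ∃ a b, a < m ∧ M < b ∧ ∀ w ∈ W, w ≤ a ∨ b ≤ w := by
  have h1 : ∀ᶠ a in nhdsWithin m (Set.Iio m), ∀ w ∈ W, w < m → w ≤ a := by
    rw [Filter.eventually_all_finset]
    intro w _
    by_cases h : w < m
    · filter_upwards [nhdsWithin_le_nhds (Ioi_mem_nhds h)] with a ha _ using le_of_lt ha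
    · exact Filter.Eventually.of_forall fun a h' => absurd h' h
  have h2 : ∀ᶠ b in nhdsWithin M (Set.Ioi M), ∀ w ∈ W, M < w → b ≤ w := by
    rw [Filter.eventually_all_finset]
    intro w _
    by_cases h : M < w
    · filter_upwards [nhdsWithin_le_nhds (Iio_mem_nhds h)] with a ha _ using le_of_lt ha
    · exact Filter.Eventually.of_forall fun a h' => absurd h' h
  obtain ⟨a, ha, ha'⟩ := (h1.and self_mem_nhdsWithin).exists
  obtain ⟨b, hb, hb'⟩ := (h2.and self_mem_nhdsWithin).exists
  refine ⟨a, b, ha', hb', fun w hw => ?_⟩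
  rcases hW w hw with h | h
  · exact Or.inl (ha w hw h)
  · exact Or.inr (hb w hw h)

section
variable {Z : Finset ℝ} {P Q : ℝ[X]} {h : ℝ ≃o ℝ}

theorem StepHyp.inj (H : StepHyp Z P Q h) {s t : ℝ} (hs : s ∉ Z) (hst : SamePos Z s t)
    (h0 : P.eval s = 0) (h1 : P.eval t = 0) : s = t := by
  have key : ∀ s t, s ∉ Z → SamePos Z s t → P.eval s = 0 → P.eval t = 0 → ¬ (s < t) := by
    intro s t hs hst h0 h1 hlt
    obtain ⟨x, hx1, hx2, hx3⟩ := poly_mvt P hlt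
    have := H.ne x ((hst.between hx1.le hx2.le).notMem hs)
    rw [h0, h1, sub_zero, eq_comm, mul_eq_zero] at hx3
    rcases hx3 with h | h
    · exact this h
    · linarith
  rcases lt_trichotomy s t with hl | he | hg
  · exact absurd hl (key s t hs hst h0 h1)
  · exact he
  · exact absurd hg (key t s (hst.notMem hs) hst.symm h1 h0)

theorem StepHyp.move (H : StepHyp Z P Q h) (S : Finset ℝ) (hS : ∀ c ∈ S, c ∉ Z ∧ P.eval c = 0) :
    ∃ u : ℝ ≃o ℝ, (∀ z ∈ Z, u z = z) ∧ ∀ c ∈ S, Q.eval (h (u c)) = 0 := by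
  classical
  induction S using Finset.induction_on with
  | empty => exact ⟨OrderIso.refl ℝ, by simp, by simp⟩
  | insert c S hcS ih =>
    obtain ⟨u, hu, huS⟩ := ih (fun c hc => hS c (Finset.mem_insert_of_mem hc))
    obtain ⟨hcZ, hc0⟩ := hS c (Finset.mem_insert_self _ _)
    obtain ⟨c', hcc', hc'0⟩ := H.exists_sign hcZ
    rw [hc0, sign_zero, sign_eq_zero_iff] at hc'0
    have hsame : SamePos Z (u c) c' := (samePos_of_fix hu c).symm.trans hcc'
    have hucZ : u c ∉ Z := (samePos_of_fix hu c).notMem hcZ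
    obtain ⟨a, b, ha, hb, hab⟩ := exists_gap (Z ∪ S.image u) (min (u c) c') (max (u c) c') (by
      intro w hw
      by_contra hcon
      push Not at hcon
      have hw' : SamePos Z (u c) w := hsame.between' (by
        rw [Set.mem_uIcc]
        rcases le_total (u c) c' with h1 | h1
        · rw [min_eq_left h1, max_eq_right h1] at hcon; exact Or.inl hcon
        · rw [min_eq_right h1, max_eq_left h1] at hcon; exact Or.inr hcon)
      rcases Finset.mem_union.1 hw with hwZ | hwS
      · exact hw'.notMem hucZ hwZ
      · obtain ⟨d, hd, rfl⟩ := Finset.mem_image.1 hwS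
        have h1 : SamePos Z c d :=
          ((samePos_of_fix hu c).trans hw').trans (samePos_of_fix hu d).symm
        have h2 := H.inj hcZ h1 hc0 (hS d (Finset.mem_insert_of_mem hd)).2
        exact hcS (h2 ▸ hd))
    obtain ⟨k, hk1, hk2, hk3⟩ := exists_orderIso_move a b (u c) c' (ha.trans_le (min_le_left _ _))
      ((le_max_left _ _).trans_lt hb) (ha.trans_le (min_le_right _ _))
      ((le_max_right _ _).trans_lt hb)
    have hkW : ∀ w ∈ Z ∪ S.image u, k w = w := by
      intro w hw
      rcases hab w hw with h1 | h1
      · exact hk2 w h1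
      · exact hk3 w h1
    refine ⟨u.trans k, ?_, ?_⟩
    · intro z hz
      rw [OrderIso.trans_apply, hu z hz, hkW z (Finset.mem_union_left _ hz)]
    · intro d hd
      rw [OrderIso.trans_apply]
      rcases Finset.mem_insert.1 hd with rfl | hd
      · rw [hk1, hc'0]
      · rw [hkW _ (Finset.mem_union_right _ (Finset.mem_image_of_mem _ hd)), huS d hd]

theorem StepHyp.symm_exists (H : StepHyp Z P Q h) {t : ℝ} (ht : t ∉ Z) :
    ∃ t', SamePos Z t t' ∧ SignType.sign (P.eval t') = SignType.sign (Q.eval (h t)) := by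
  obtain ⟨t', h1, h2⟩ := H.symm.exists_sign (t := h t) (by simpa using ht)
  refine ⟨h.symm t', ?_, h2⟩
  rw [← samePos_map_iff h]
  simpa using h1

theorem StepHyp.sign_pos' (H : StepHyp Z P Q h) {u : ℝ ≃o ℝ} (hu : ∀ z ∈ Z, u z = z)
    {t c : ℝ} (ht : t ∉ Z) (hpos : 0 < P.derivative.eval t) (hc : SamePos Z t c)
    (h0 : P.eval c = 0) (h1 : Q.eval (h (u c)) = 0) :
    SignType.sign (P.eval t) = SignType.sign (Q.eval (h (u t))) := by
  have hut := samePos_of_fix hu t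
  have huc := samePos_of_fix hu c
  have hQpos : 0 < Q.derivative.eval (h (u t)) := by
    have h2 := hut.sign_eq ht P.derivative.continuous H.ne
    rwa [H.der (u t), sign_pos hpos, eq_comm, sign_eq_one_iff] at h2
  have hutZ : h (u t) ∉ Z.map h.toEmbedding := by
    simpa using hut.notMem ht
  have hs2 : SamePos (Z.map h.toEmbedding) (h (u t)) (h (u c)) := by
    rw [samePos_map_iff]
    exact hut.symm.trans (hc.trans huc)
  rcases lt_trichotomy t c with hl | rfl | hl
  · have a1 := poly_mono H.ne ht (SamePos.refl _ _) hc hpos hl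
    have a2 := poly_mono H.symm.ne hutZ (SamePos.refl _ _) hs2 hQpos (by simpa using hl)
    rw [h0] at a1
    rw [h1] at a2
    rw [sign_neg a1, sign_neg a2]
  · rw [h0, h1]
  · have a1 := poly_mono H.ne ht hc (SamePos.refl _ _) hpos hl
    have a2 := poly_mono H.symm.ne hutZ hs2 (SamePos.refl _ _) hQpos (by simpa using hl)
    rw [h0] at a1
    rw [h1] at a2
    rw [sign_pos a1, sign_pos a2]

theorem StepHyp.extend (H : StepHyp Z P Q h) :
    ∃ u : ℝ ≃o ℝ, (∀ z ∈ Z, u z = z) ∧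
      ∀ t, SignType.sign (P.eval t) = SignType.sign (Q.eval (h (u t))) := by
  classical
  by_cases hP : P = 0
  · -- then the derivative vanishes, so everything is in `Z`: impossible
    exfalso
    obtain ⟨t, ht⟩ := Infinite.exists_notMem_finset Z
    exact H.ne t ht (by simp [hP])
  obtain ⟨u, hu, hc⟩ := H.move (P.roots.toFinset \ Z) (by
    intro c hc
    rw [Finset.mem_sdiff, Multiset.mem_toFinset, mem_roots hP] at hc
    exact ⟨hc.2, hc.1⟩)
  have hc' : ∀ c, c ∉ Z → P.eval c = 0 → Q.eval (h (u c)) = 0 := by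
    intro c hcZ hc0
    apply hc
    rw [Finset.mem_sdiff, Multiset.mem_toFinset, mem_roots hP]
    exact ⟨hc0, hcZ⟩
  refine ⟨u, hu, fun t => ?_⟩
  by_cases ht : t ∈ Z
  · rw [hu t ht, H.val t ht]
  have hut := samePos_of_fix hu t
  by_cases hroot : ∃ c, SamePos Z t c ∧ P.eval c = 0
  · obtain ⟨c, hc1, hc2⟩ := hroot
    rcases lt_or_gt_of_ne (H.ne t ht) with h1 | h1
    · have := H.neg.sign_pos' hu ht (by simpa using h1) hc1 (by simpa using hc2)
        (by simpa using hc' c (hc1.notMem ht) hc2)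
      simpa [Left.sign_neg] using this
    · exact H.sign_pos' hu ht h1 hc1 hc2 (hc' c (hc1.notMem ht) hc2)
  · push Not at hroot
    obtain ⟨t', h1, h2⟩ := H.symm_exists (hut.notMem ht)
    rw [← h2]
    have h3 : SamePos Z t t' := hut.trans h1
    exact sign_const_of_ne P.continuous fun x hx => hroot x (h3.between' hx)

end

/-- the extension step for a finite family -/
theorem family_extend {ι : Type*} (s : Finset ι) (p q : ι → ℝ[X]) (P Q : ℝ[X])
    (h : ℝ ≃o ℝ) (hp : ∀ i ∈ s, p i ≠ 0)
    (hh : ∀ i ∈ s, ∀ t, SignType.sign ((p i).eval t) = SignType.sign ((q i).eval (h t)))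
    (j : ι) (hj : j ∈ s) (hjp : p j = P.derivative) (hjq : q j = Q.derivative)
    (hval : ∀ i ∈ s, ∀ z, (p i).eval z = 0 →
      SignType.sign (P.eval z) = SignType.sign (Q.eval (h z))) :
    ∃ h' : ℝ ≃o ℝ,
      (∀ i ∈ s, ∀ t, SignType.sign ((p i).eval t) = SignType.sign ((q i).eval (h' t))) ∧
      ∀ t, SignType.sign (P.eval t) = SignType.sign (Q.eval (h' t)) := by
  classical
  set Z : Finset ℝ := s.biUnion fun i => (p i).roots.toFinset with hZ
  have hZmem : ∀ z, z ∈ Z ↔ ∃ i ∈ s, (p i).eval z = 0 := by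
    intro z
    simp only [hZ, Finset.mem_biUnion, Multiset.mem_toFinset]
    constructor
    · rintro ⟨i, hi, h⟩
      rw [mem_roots (hp i hi)] at h
      exact ⟨i, hi, h⟩
    · rintro ⟨i, hi, h⟩
      refine ⟨i, hi, ?_⟩
      rw [mem_roots (hp i hi)]
      exact h
  have H : StepHyp Z P Q h := by
    refine ⟨?_, ?_, ?_⟩
    · intro t ht h0
      exact ht ((hZmem t).2 ⟨j, hj, by rw [hjp]; exact h0⟩)
    · intro t
      rw [← hjp, ← hjq]
      exact hh j hj t
    · intro z hz
      obtain ⟨i, hi, h0⟩ := (hZmem z).1 hz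
      exact hval i hi z h0
  obtain ⟨u, hu, hPQ⟩ := H.extend
  refine ⟨u.trans h, ?_, fun t => by simpa using hPQ t⟩
  intro i hi t
  rw [OrderIso.trans_apply, ← hh i hi]
  by_cases ht : t ∈ Z
  · rw [hu t ht]
  · have h1 := samePos_of_fix hu t
    refine sign_const_of_ne (p i).continuous fun x hx h0 => ?_
    exact (h1.between' hx).notMem ht ((hZmem x).2 ⟨i, hi, h0⟩)
end part3

section part4
open Polynomial

theorem dm_of_cons (a : ℕ) (M Y : Multiset ℕ) (hY : ∀ y ∈ Y, y < a) :
    Multiset.IsDershowitzMannaLT (M + Y) (a ::ₘ M) :=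
  ⟨M, Y, {a}, by simp, rfl, by rw [← Multiset.singleton_add, add_comm], by simpa using hY⟩

theorem map_eval_of_lead_zero {A : Type*} [CommRing A] (x : A →+* ℝ) (q : A[X])
    (h : x q.leadingCoeff = 0) : q.eraseLead.map x = q.map x := by
  have e := congrArg (Polynomial.map x) q.eraseLead_add_C_mul_X_pow
  rw [Polynomial.map_add, Polynomial.map_mul, map_C, h, C_0, zero_mul, add_zero] at e
  exact e

theorem tarski_step_sign {A : Type*} [CommRing A] (x y : A →+* ℝ) (p q r s : A[X]) (m : ℕ)
    (e : C (q.leadingCoeff ^ m) * p = s * q + r)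
    (hx : x q.leadingCoeff ≠ 0)
    (hl : SignType.sign (x q.leadingCoeff) = SignType.sign (y q.leadingCoeff))
    (z w : ℝ) (hz : (q.map x).eval z = 0) (hw : (q.map y).eval w = 0)
    (hr : SignType.sign ((r.map x).eval z) = SignType.sign ((r.map y).eval w)) :
    SignType.sign ((p.map x).eval z) = SignType.sign ((p.map y).eval w) := by
  have e1 := congrArg (fun f : A[X] => (f.map x).eval z) e
  have e2 := congrArg (fun f : A[X] => (f.map y).eval w) e
  simp only [Polynomial.map_mul, Polynomial.map_add, map_C, eval_mul, eval_add, eval_C, hz, hw,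
    mul_zero, zero_add] at e1 e2
  rw [← e1, ← e2, sign_mul, sign_mul, map_pow x, map_pow y, sign_pow, sign_pow, ← hl] at hr
  exact mul_left_cancel₀ (pow_ne_zero _ (by simpa [sign_eq_zero_iff] using hx)) hr

theorem tarski_main {A : Type*} [CommRing A] : ∀ L : Multiset A[X], ∃ C : Finset A,
    ∀ x y : A →+* ℝ, (∀ c ∈ C, SignType.sign (x c) = SignType.sign (y c)) →
      ∃ h : ℝ ≃o ℝ, ∀ p ∈ L, ∀ t,
        SignType.sign ((p.map x).eval t) = SignType.sign ((p.map y).eval (h t)) := by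
  classical
  intro L
  induction L using (InvImage.wf (fun L : Multiset A[X] => L.map natDegree)
    (Multiset.wellFounded_isDershowitzMannaLT (α := ℕ))).induction with
  | _ L ih =>
  by_cases hall : ∀ p ∈ L, p.natDegree = 0
  · refine ⟨(L.map fun p => p.coeff 0).toFinset, fun x y hxy => ⟨OrderIso.refl ℝ, ?_⟩⟩
    intro p hp t
    have := hxy (p.coeff 0) (by
      rw [Multiset.mem_toFinset, Multiset.mem_map]; exact ⟨p, hp, rfl⟩)
    rw [eq_C_of_natDegree_eq_zero (hall p hp)]
    simpa using this
  push Not at hall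
  obtain ⟨p0, hp0, hp0d⟩ := hall
  obtain ⟨p, hpL, hpmax⟩ : ∃ p ∈ L, ∀ q ∈ L, q.natDegree ≤ p.natDegree := by
    obtain ⟨p, hp, h⟩ := Finset.exists_max_image L.toFinset natDegree ⟨p0, by simpa using hp0⟩
    exact ⟨p, by simpa using hp, fun q hq => h q (by simpa using hq)⟩
  have hpd : 1 ≤ p.natDegree := le_trans (by omega) (hpmax p0 hp0)
  set M := L.erase p with hM
  have hLM : L = p ::ₘ M := (Multiset.cons_erase hpL).symm
  have hML : ∀ q ∈ M, q ∈ L := fun q hq => by rw [hLM]; exact Multiset.mem_cons_of_mem hq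
  -- truncations
  have h1 : ∀ q : A[X], ∃ C : Finset A, (q ∈ L ∧ 1 ≤ q.natDegree) →
      ∀ x y : A →+* ℝ, (∀ c ∈ C, SignType.sign (x c) = SignType.sign (y c)) →
      ∃ h : ℝ ≃o ℝ, ∀ p ∈ q.eraseLead ::ₘ L.erase q, ∀ t,
        SignType.sign ((p.map x).eval t) = SignType.sign ((p.map y).eval (h t)) := by
    intro q
    by_cases hq : q ∈ L ∧ 1 ≤ q.natDegree
    · obtain ⟨C, hC⟩ := ih (q.eraseLead ::ₘ L.erase q) (by
        change Multiset.IsDershowitzMannaLT _ _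
        dsimp only
        conv_rhs => rw [← Multiset.cons_erase hq.1]
        rw [Multiset.map_cons, Multiset.map_cons, ← Multiset.singleton_add, add_comm]
        refine dm_of_cons _ _ _ ?_
        have := q.eraseLead_natDegree_le
        simp only [Multiset.mem_singleton, forall_eq]
        omega)
      exact ⟨C, fun _ => hC⟩
    · exact ⟨∅, fun h => absurd h hq⟩
  choose Ct hCt using h1
  -- remainders
  have h2 : ∀ q : A[X], ∃ (m : ℕ) (r s : A[X]), q.natDegree ≤ p.natDegree →
      (r.natDegree < p.natDegree ∧ (1 ≤ q.natDegree → C (q.leadingCoeff ^ m) * p = s * q + r)) := by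
    intro q
    by_cases hq : 1 ≤ q.natDegree
    · obtain ⟨m, r, s, hr, e⟩ := exists_pseudo_rem q hq _ p le_rfl
      exact ⟨m, r, s, fun h => ⟨hr.trans_le h, fun _ => e⟩⟩
    · exact ⟨0, 0, 0, fun _ => ⟨by simp; omega, fun h => absurd h hq⟩⟩
  choose em rem es hrem using h2
  have hdd : p.derivative.natDegree < p.natDegree := natDegree_derivative_lt (by omega)
  obtain ⟨C', hC'⟩ := ih (M + (p.derivative ::ₘ (p.derivative ::ₘ M).map rem)) (by
    change Multiset.IsDershowitzMannaLT _ _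
    dsimp only
    rw [hLM, Multiset.map_cons natDegree, Multiset.map_add]
    refine dm_of_cons _ _ _ ?_
    intro y hy
    simp only [Multiset.map_cons, Multiset.mem_cons, Multiset.map_map, Multiset.mem_map] at hy
    rcases hy with rfl | rfl | ⟨q, hq, rfl⟩
    · exact hdd
    · exact (hrem _ hdd.le).1
    · exact (hrem q (hpmax q (hML q hq))).1)
  refine ⟨(L.map leadingCoeff).toFinset ∪ L.toFinset.biUnion Ct ∪ C', fun x y hxy => ?_⟩
  have hlead : ∀ q ∈ L, SignType.sign (x q.leadingCoeff) = SignType.sign (y q.leadingCoeff) := by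
    intro q hq
    apply hxy
    refine Finset.mem_union_left _ (Finset.mem_union_left _ ?_)
    rw [Multiset.mem_toFinset, Multiset.mem_map]
    exact ⟨q, hq, rfl⟩
  have hlead0 : ∀ q ∈ L, (x q.leadingCoeff = 0 ↔ y q.leadingCoeff = 0) := by
    intro q hq
    rw [← sign_eq_zero_iff, hlead q hq, sign_eq_zero_iff]
  by_cases hz : ∃ q ∈ L, 1 ≤ q.natDegree ∧ x q.leadingCoeff = 0
  · obtain ⟨q, hqL, hqd, hq0⟩ := hz
    obtain ⟨h, hh⟩ := hCt q ⟨hqL, hqd⟩ x y (fun c hc => hxy c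
      (Finset.mem_union_left _ (Finset.mem_union_right _
        (Finset.mem_biUnion.2 ⟨q, by simpa using hqL, hc⟩))))
    refine ⟨h, fun r hr t => ?_⟩
    rw [← Multiset.cons_erase hqL, Multiset.mem_cons] at hr
    rcases hr with rfl | hr
    · have := hh r.eraseLead (Multiset.mem_cons_self _ _) t
      rwa [map_eval_of_lead_zero x r hq0,
        map_eval_of_lead_zero y r ((hlead0 r hqL).1 hq0)] at this
    · exact hh r (Multiset.mem_cons_of_mem hr) t
  push Not at hz
  obtain ⟨h, hh⟩ := hC' x y (fun c hc => hxy c (Finset.mem_union_right _ hc))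
  have hxp : x p.leadingCoeff ≠ 0 := hz p hpL hpd
  -- leading coefficient of the derivative
  have hdcoef : p.derivative.coeff (p.natDegree - 1) = p.leadingCoeff * (p.natDegree : A) := by
    rw [coeff_derivative, Nat.sub_add_cancel hpd, leadingCoeff]
    congr 1
    exact_mod_cast congrArg (Nat.cast : ℕ → A) (Nat.sub_add_cancel hpd)
  have hdx : x (p.derivative.coeff (p.natDegree - 1)) ≠ 0 := by
    rw [hdcoef, map_mul, map_natCast]
    exact mul_ne_zero hxp (by exact_mod_cast (by omega : p.natDegree ≠ 0))
  have hdnat : p.derivative.natDegree = p.natDegree - 1 := by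
    refine natDegree_eq_of_le_of_coeff_ne_zero (by omega) ?_
    intro h0
    exact hdx (by rw [h0, map_zero])
  have hdlead : p.derivative.leadingCoeff = p.leadingCoeff * (p.natDegree : A) := by
    rw [leadingCoeff, hdnat, hdcoef]
  have hdlx : x p.derivative.leadingCoeff ≠ 0 := by
    rw [leadingCoeff, hdnat]; exact hdx
  have hdls : SignType.sign (x p.derivative.leadingCoeff) =
      SignType.sign (y p.derivative.leadingCoeff) := by
    rw [hdlead, map_mul x, map_mul y, map_natCast x, map_natCast y, sign_mul, sign_mul, hlead p hpL]
  -- apply the extension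
  obtain ⟨h', hs', hp'⟩ := family_extend
    ((p.derivative ::ₘ M).toFinset.filter (fun q => q.map x ≠ 0)) (fun q => q.map x)
    (fun q => q.map y) (p.map x) (p.map y) h
    (fun q hq => (Finset.mem_filter.1 hq).2)
    (by
      intro q hq t
      have hq1 := (Finset.mem_filter.1 hq).1
      rw [Multiset.mem_toFinset, Multiset.mem_cons] at hq1
      refine hh q ?_ t
      rw [Multiset.mem_add, Multiset.mem_cons]
      tauto)
    p.derivative
    (by
      rw [Finset.mem_filter]
      refine ⟨by simp, fun h0 => hdx ?_⟩
      rw [← coeff_map, h0, coeff_zero])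
    (by simp only [derivative_map]) (by simp only [derivative_map])
    (by
      intro q hq z hqz
      have hqm := (Finset.mem_filter.1 hq).2
      have hq1 := (Finset.mem_filter.1 hq).1
      rw [Multiset.mem_toFinset, Multiset.mem_cons] at hq1
      have hqdeg : 1 ≤ q.natDegree := by
        by_contra hcon
        have h0 : q.natDegree = 0 := by omega
        rw [eq_C_of_natDegree_eq_zero h0] at hqz hqm
        simp at hqz
        simp [hqz] at hqm
      have hqle : q.natDegree ≤ p.natDegree := by
        rcases hq1 with rfl | hq1
        · exact hdd.le
        · exact hpmax q (hML q hq1)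
      have hqx : x q.leadingCoeff ≠ 0 := by
        rcases hq1 with rfl | hq1
        · exact hdlx
        · exact hz q (hML q hq1) hqdeg
      have hqs : SignType.sign (x q.leadingCoeff) = SignType.sign (y q.leadingCoeff) := by
        rcases hq1 with rfl | hq1
        · exact hdls
        · exact hlead q (hML q hq1)
      have hqw : (q.map y).eval (h z) = 0 := by
        have := hh q (by rw [Multiset.mem_add, Multiset.mem_cons]; tauto) z
        rwa [hqz, sign_zero, eq_comm, sign_eq_zero_iff] at this
      refine tarski_step_sign x y p q (rem q) (es q) (em q) ((hrem q hqle).2 hqdeg) hqx hqs z (h z)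
        hqz hqw (hh _ ?_ z)
      rw [Multiset.mem_add, Multiset.mem_cons]
      right; right
      rw [Multiset.mem_map]
      exact ⟨q, by rw [Multiset.mem_cons]; exact hq1, rfl⟩)
  refine ⟨h', fun q hq t => ?_⟩
  rw [hLM, Multiset.mem_cons] at hq
  rcases hq with rfl | hq
  · exact hp' t
  · by_cases hqm : q.map x = 0
    · have hd0 : q.natDegree = 0 := by
        by_contra hcon
        refine hz q (hML q hq) (by omega) ?_
        rw [leadingCoeff, ← coeff_map, hqm, coeff_zero]
      have hl := (hlead0 q (hML q hq)).1 (by rw [leadingCoeff, ← coeff_map, hqm, coeff_zero])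
      rw [leadingCoeff, hd0] at hl
      have : q.map y = 0 := by
        rw [eq_C_of_natDegree_eq_zero hd0, map_C, hl, C_0]
      rw [hqm, this]; simp
    · exact hs' q (by rw [Finset.mem_filter]; exact ⟨by simp [hq], hqm⟩) t
end part4

section part5
open Polynomial

section SA

/-- Polynomial functions on a real vector space. -/
def PolyAlg (E : Type) [AddCommGroup E] [Module ℝ E] : Subalgebra ℝ (E → ℝ) :=
  Algebra.adjoin ℝ {f | IsLinearMap ℝ f}

/-- Polynomial functions on a real vector space. -/
def IsPolyFn {E : Type} [AddCommGroup E] [Module ℝ E] (f : E → ℝ) : Prop := f ∈ PolyAlg E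

variable {E F : Type} [AddCommGroup E] [Module ℝ E] [AddCommGroup F] [Module ℝ F]

theorem IsPolyFn.lin {f : E → ℝ} (h : IsLinearMap ℝ f) : IsPolyFn f := Algebra.subset_adjoin h
theorem IsPolyFn.add {f g : E → ℝ} (hf : IsPolyFn f) (hg : IsPolyFn g) : IsPolyFn fun x => f x + g x :=
  (PolyAlg E).add_mem hf hg
theorem IsPolyFn.sub {f g : E → ℝ} (hf : IsPolyFn f) (hg : IsPolyFn g) : IsPolyFn fun x => f x - g x :=
  (PolyAlg E).sub_mem hf hg
theorem IsPolyFn.mul {f g : E → ℝ} (hf : IsPolyFn f) (hg : IsPolyFn g) : IsPolyFn fun x => f x * g x :=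
  (PolyAlg E).mul_mem hf hg
theorem IsPolyFn.neg {f : E → ℝ} (hf : IsPolyFn f) : IsPolyFn fun x => - f x :=
  (PolyAlg E).neg_mem hf
theorem IsPolyFn.const (c : ℝ) : IsPolyFn fun _ : E => c :=
  (PolyAlg E).algebraMap_mem c

theorem IsPolyFn.comp {f : E → ℝ} (hf : IsPolyFn f) {g : F → E} (hg : IsLinearMap ℝ g) :
    IsPolyFn fun x => f (g x) := by
  induction hf using Algebra.adjoin_induction with
  | mem f hf => exact IsPolyFn.lin ⟨fun x y => by rw [hg.map_add, hf.map_add],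
      fun c x => by rw [hg.map_smul, hf.map_smul]⟩
  | algebraMap r => exact IsPolyFn.const r
  | add f g _ _ h1 h2 => exact h1.add h2
  | mul f g _ _ h1 h2 => exact h1.mul h2

/-- Semialgebraic sets in a vector space, as unions of sign classes. -/
def SA (S : Set E) : Prop := ∃ C : Finset (E → ℝ), (∀ c ∈ C, IsPolyFn c) ∧
  ∀ x y, (∀ c ∈ C, SignType.sign (c x) = SignType.sign (c y)) → (x ∈ S → y ∈ S)

theorem SA.not {P : E → Prop} (h : SA {x | P x}) : SA {x | ¬ P x} := by
  obtain ⟨C, hC, h⟩ := h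
  exact ⟨C, hC, fun x y hxy hx hy => hx (h y x (fun c hc => (hxy c hc).symm) hy)⟩

theorem SA.and {P Q : E → Prop} (h : SA {x | P x}) (h' : SA {x | Q x}) :
    SA {x | P x ∧ Q x} := by
  classical
  obtain ⟨C, hC, h⟩ := h
  obtain ⟨C', hC', h'⟩ := h'
  refine ⟨C ∪ C', ?_, fun x y hxy hx => ⟨?_, ?_⟩⟩
  · intro c hc
    rcases Finset.mem_union.1 hc with h | h
    · exact hC c h
    · exact hC' c h
  · exact h x y (fun c hc => hxy c (Finset.mem_union_left _ hc)) hx.1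
  · exact h' x y (fun c hc => hxy c (Finset.mem_union_right _ hc)) hx.2

theorem SA.or {P Q : E → Prop} (h : SA {x | P x}) (h' : SA {x | Q x}) :
    SA {x | P x ∨ Q x} := by
  have := (h.not.and h'.not).not
  convert this using 3
  tauto

theorem SA.imp {P Q : E → Prop} (h : SA {x | P x}) (h' : SA {x | Q x}) :
    SA {x | P x → Q x} := by
  have := (h.and h'.not).not
  convert this using 3
  tauto

theorem SA.true : SA {_x : E | True} := ⟨∅, by simp, by simp⟩

theorem SA.allFinset {ι : Type*} (s : Finset ι) {P : ι → E → Prop} (h : ∀ i ∈ s, SA {x | P i x}) :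
    SA {x | ∀ i ∈ s, P i x} := by
  classical
  induction s using Finset.induction_on with
  | empty => simpa using SA.true
  | insert a s _ ih =>
    have := (h a (by simp)).and (ih (fun i hi => h i (by simp [hi])))
    convert this using 3
    simp

theorem SA.allFin {ι : Type*} [Fintype ι] {P : ι → E → Prop} (h : ∀ i, SA {x | P i x}) :
    SA {x | ∀ i, P i x} := by
  simpa using SA.allFinset Finset.univ (fun i _ => h i)

theorem SA.exFin {ι : Type*} [Fintype ι] {P : ι → E → Prop} (h : ∀ i, SA {x | P i x}) :
    SA {x | ∃ i, P i x} := by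
  have := (SA.allFin (fun i => (h i).not)).not
  simpa using this

theorem SA.pos {f : E → ℝ} (hf : IsPolyFn f) : SA {x | 0 < f x} := by
  refine ⟨{f}, by simpa using hf, fun x y hxy hx => ?_⟩
  have := hxy f (by simp)
  simp only [Set.mem_setOf_eq] at hx ⊢
  rwa [sign_pos hx, eq_comm, sign_eq_one_iff] at this

theorem SA.lt {f g : E → ℝ} (hf : IsPolyFn f) (hg : IsPolyFn g) : SA {x | f x < g x} := by
  simpa using SA.pos (hg.sub hf)

theorem SA.le {f g : E → ℝ} (hf : IsPolyFn f) (hg : IsPolyFn g) : SA {x | f x ≤ g x} := by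
  simpa using (SA.lt hg hf).not

theorem SA.eq {f g : E → ℝ} (hf : IsPolyFn f) (hg : IsPolyFn g) : SA {x | f x = g x} := by
  have := (SA.le hf hg).and (SA.le hg hf)
  convert this using 3
  exact le_antisymm_iff

theorem SA.comp {S : Set E} (hS : SA S) {g : F → E} (hg : IsLinearMap ℝ g) :
    SA {x | g x ∈ S} := by
  classical
  obtain ⟨C, hC, h⟩ := hS
  refine ⟨C.image (fun f x => f (g x)), ?_, ?_⟩
  · intro c hc
    obtain ⟨f, hf, rfl⟩ := Finset.mem_image.1 hc
    exact (hC f hf).comp hg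
  · intro x y hxy hx
    exact h _ _ (fun c hc => hxy _ (Finset.mem_image_of_mem _ hc)) hx

/-- evaluation homomorphism -/
def evHom (x : E) : PolyAlg E →+* ℝ := (Pi.evalRingHom (fun _ : E => ℝ) x).comp (PolyAlg E).val.toRingHom

theorem evHom_apply (x : E) (f : PolyAlg E) : evHom x f = f.1 x := rfl

theorem IsPolyFn.exists_poly {f : E × ℝ → ℝ} (hf : IsPolyFn f) :
    ∃ P : (PolyAlg E)[X], ∀ x t, f (x, t) = (P.map (evHom x)).eval t := by
  induction hf using Algebra.adjoin_induction with
  | mem f hf =>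
    have h1 : IsPolyFn fun x : E => f (x, 0) := IsPolyFn.lin
      ⟨fun x y => by rw [← hf.map_add]; simp, fun c x => by rw [← hf.map_smul]; simp⟩
    refine ⟨C ⟨_, h1⟩ + C (algebraMap ℝ _ (f (0, 1))) * X, fun x t => ?_⟩
    have : (x, t) = (x, (0:ℝ)) + t • ((0 : E), (1:ℝ)) := by simp
    rw [this, hf.map_add, hf.map_smul]
    simp only [Polynomial.map_add, Polynomial.map_mul, map_C, map_X, eval_add, eval_mul, eval_C,
      eval_X, evHom_apply, smul_eq_mul]
    rw [mul_comm]
    rfl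
  | algebraMap r => exact ⟨C (algebraMap ℝ _ r), fun x t => by simp [evHom_apply]⟩
  | add f g _ _ h1 h2 =>
    obtain ⟨P, hP⟩ := h1
    obtain ⟨Q, hQ⟩ := h2
    exact ⟨P + Q, fun x t => by simp [hP, hQ]⟩
  | mul f g _ _ h1 h2 =>
    obtain ⟨P, hP⟩ := h1
    obtain ⟨Q, hQ⟩ := h2
    exact ⟨P * Q, fun x t => by simp [hP, hQ]⟩

/-- Tarski–Seidenberg -/
theorem SA.ex {P : E → ℝ → Prop} (h : SA {q : E × ℝ | P q.1 q.2}) : SA {x | ∃ t, P x t} := by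
  classical
  obtain ⟨D, hD, h⟩ := h
  have h1 : ∀ f : E × ℝ → ℝ, ∃ Q : (PolyAlg E)[X], f ∈ D →
      ∀ x t, f (x, t) = (Q.map (evHom x)).eval t := by
    intro f
    by_cases hf : f ∈ D
    · obtain ⟨Q, hQ⟩ := (hD f hf).exists_poly
      exact ⟨Q, fun _ => hQ⟩
    · exact ⟨0, fun h => absurd h hf⟩
  choose Q hQ using h1
  obtain ⟨C, hC⟩ := tarski_main (D.val.map Q)
  refine ⟨C.image (fun c => c.1), ?_, ?_⟩
  · intro c hc
    obtain ⟨f, hf, rfl⟩ := Finset.mem_image.1 hc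
    exact f.2
  · rintro x y hxy ⟨t, ht⟩
    obtain ⟨k, hk⟩ := hC (evHom x) (evHom y)
      (fun c hc => hxy c.1 (Finset.mem_image.2 ⟨c, hc, rfl⟩))
    refine ⟨k t, h (x, t) (y, k t) (fun f hf => ?_) ht⟩
    rw [hQ f hf, hQ f hf]
    exact hk _ (Multiset.mem_map.2 ⟨f, hf, rfl⟩) t

theorem SA.all {P : E → ℝ → Prop} (h : SA {q : E × ℝ | P q.1 q.2}) : SA {x | ∀ t, P x t} := by
  have h2 : SA {q : E × ℝ | ¬ P q.1 q.2} := h.not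
  have := (SA.ex (P := fun x t => ¬ P x t) h2).not
  simpa using this

theorem SA.exV {n : ℕ} {E : Type} [AddCommGroup E] [Module ℝ E] {P : E → (Fin n → ℝ) → Prop}
    (h : SA {q : E × (Fin n → ℝ) | P q.1 q.2}) : SA {x | ∃ v, P x v} := by
  induction n generalizing E with
  | zero =>
    have := h.comp (g := fun x : E => (x, (0 : Fin 0 → ℝ)))
      ⟨fun x y => by simp, fun c x => by simp⟩
    convert this using 3 with x
    constructor
    · rintro ⟨v, hv⟩
      rw [Subsingleton.elim v 0] at hv
      exact hv
    · intro h; exact ⟨_, h⟩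
  | succ n ih =>
    have h1 : SA {q : (E × ℝ) × (Fin n → ℝ) | P q.1.1 (Fin.cons q.1.2 q.2)} := by
      refine h.comp (g := fun q : (E × ℝ) × (Fin n → ℝ) =>
        (q.1.1, (Fin.cons q.1.2 q.2 : Fin (n + 1) → ℝ))) ⟨fun x y => ?_, fun c x => ?_⟩
      · refine Prod.ext rfl (funext fun i => ?_)
        refine Fin.cases ?_ (fun j => ?_) i <;> simp
      · refine Prod.ext rfl (funext fun i => ?_)
        refine Fin.cases ?_ (fun j => ?_) i <;> simp
    have h2 := SA.ex (P := fun x t => ∃ w : Fin n → ℝ, P x (Fin.cons t w))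
      (ih (P := fun (q : E × ℝ) w => P q.1 (Fin.cons q.2 w)) h1)
    convert h2 using 3 with x
    constructor
    · rintro ⟨v, hv⟩
      exact ⟨v 0, Fin.tail v, by rwa [Fin.cons_self_tail]⟩
    · rintro ⟨t, w, hw⟩
      exact ⟨_, hw⟩

theorem SA.allV {n : ℕ} {P : E → (Fin n → ℝ) → Prop}
    (h : SA {q : E × (Fin n → ℝ) | P q.1 q.2}) : SA {x | ∀ v, P x v} := by
  have h2 : SA {q : E × (Fin n → ℝ) | ¬ P q.1 q.2} := h.not
  have := (SA.exV (P := fun x t => ¬ P x t) h2).not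
  simpa using this

end SA

/-! growth -/

theorem poly_bound (a : ℝ[X]) : ∃ (K : ℝ) (N : ℕ), 0 ≤ K ∧ ∀ R : ℝ, 1 ≤ R → |a.eval R| ≤ K * R ^ N := by
  refine ⟨∑ i ∈ Finset.range (a.natDegree + 1), |a.coeff i|, a.natDegree,
    Finset.sum_nonneg fun i _ => abs_nonneg _, fun R hR => ?_⟩
  rw [eval_eq_sum_range, Finset.sum_mul]
  refine (Finset.abs_sum_le_sum_abs _ _).trans (Finset.sum_le_sum fun i hi => ?_)
  rw [abs_mul, abs_pow, abs_of_nonneg (by linarith : (0:ℝ) ≤ R)]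
  refine mul_le_mul_of_nonneg_left (pow_le_pow_right₀ hR ?_) (abs_nonneg _)
  simpa [Nat.lt_succ_iff] using hi

theorem poly_lower (a : ℝ[X]) (ha : a ≠ 0) : ∃ c R0 : ℝ, 0 < c ∧ ∀ R, R0 ≤ R → c ≤ |a.eval R| := by
  by_cases h : 0 < a.degree
  · obtain ⟨R0, h0⟩ := Filter.eventually_atTop.1 ((a.abs_tendsto_atTop h).eventually_ge_atTop 1)
    exact ⟨1, R0, one_pos, h0⟩
  · push Not at h
    rw [eq_C_of_degree_le_zero h] at ha ⊢
    refine ⟨|a.coeff 0|, 0, ?_, by simp⟩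
    rw [abs_pos]
    intro h0
    exact ha (by rw [h0, C_0])

theorem sign_eventually (P : ℝ[X][X]) : ∃ (K : ℝ) (N : ℕ) (R0 : ℝ), 0 ≤ K ∧ 1 ≤ R0 ∧
    ∀ R, R0 ≤ R → ∀ s s', K * R ^ N < s → K * R ^ N < s' →
      SignType.sign ((P.map (evalRingHom R)).eval s) =
        SignType.sign ((P.map (evalRingHom R)).eval s') := by
  by_cases hP : P = 0
  · exact ⟨0, 0, 1, le_rfl, le_rfl, by simp [hP]⟩
  obtain ⟨c, R0, hc, hcR⟩ := poly_lower P.leadingCoeff (leadingCoeff_ne_zero.2 hP)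
  have hb := fun i => poly_bound (P.coeff i)
  choose K N hK hKN using hb
  set KK := ∑ i ∈ Finset.range P.natDegree, K i with hKK
  set NN := ∑ i ∈ Finset.range P.natDegree, N i with hNN
  have hKK0 : 0 ≤ KK := Finset.sum_nonneg fun i _ => hK i
  refine ⟨KK / c + 1, NN, max R0 1, by positivity, le_max_right _ _, fun R hR => ?_⟩
  have hR1 : 1 ≤ R := (le_max_right _ _).trans hR
  have hR0 : R0 ≤ R := (le_max_left _ _).trans hR
  have hcoef : ∀ i ∈ Finset.range P.natDegree, |(P.coeff i).eval R| ≤ KK * R ^ NN := by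
    intro i hi
    refine (hKN i R hR1).trans (mul_le_mul ?_ (pow_le_pow_right₀ hR1 ?_) (by positivity) hKK0)
    · exact Finset.single_le_sum (f := K) (fun j _ => hK j) hi
    · exact Finset.single_le_sum (f := N) (fun j _ => Nat.zero_le _) hi
  have hroot : ∀ s, (KK / c + 1) * R ^ NN < s → (P.map (evalRingHom R)).eval s ≠ 0 := by
    intro s hs h0
    have hlead : (evalRingHom R) P.leadingCoeff ≠ 0 := by
      intro h
      have := hcR R hR0
      rw [coe_evalRingHom] at h
      rw [h] at this
      simp at this
      linarith
    have hne : P.map (evalRingHom R) ≠ 0 := by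
      intro h
      have := coeff_map (p := P) (evalRingHom R) P.natDegree
      rw [h, coeff_zero] at this
      exact hlead this.symm
    have h1 := IsRoot.norm_lt_cauchyBound hne h0
    have h2 : ((P.map (evalRingHom R)).cauchyBound : ℝ) ≤ (KK / c + 1) * R ^ NN := by
      rw [cauchyBound, natDegree_map_of_leadingCoeff_ne_zero _ hlead,
        leadingCoeff_map_of_leadingCoeff_ne_zero _ hlead]
      have h3 : ((Finset.range P.natDegree).sup fun i => ‖(P.map (evalRingHom R)).coeff i‖₊ : NNReal)
          ≤ (KK * R ^ NN).toNNReal := by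
        refine Finset.sup_le fun i hi => ?_
        rw [← NNReal.coe_le_coe, Real.coe_toNNReal _ (by positivity)]
        simpa using hcoef i hi
      have h4 : (((Finset.range P.natDegree).sup fun i => ‖(P.map (evalRingHom R)).coeff i‖₊ : NNReal) : ℝ)
          ≤ KK * R ^ NN := by
        rw [← NNReal.coe_le_coe, Real.coe_toNNReal _ (by positivity)] at h3
        exact h3
      push_cast
      have h5 := hcR R hR0
      have h6 : (1:ℝ) ≤ R ^ NN := one_le_pow₀ hR1
      have h7 : (((Finset.range P.natDegree).sup fun i => ‖(P.map (evalRingHom R)).coeff i‖₊ : NNReal) : ℝ) /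
          ‖(evalRingHom R) P.leadingCoeff‖ ≤ KK * R ^ NN / c :=
        div_le_div₀ (by positivity) h4 hc (by simpa using h5)
      have h8 : (KK / c + 1) * R ^ NN = KK * R ^ NN / c + R ^ NN := by ring
      rw [h8]
      exact add_le_add h7 h6
    have h9 := Real.le_norm_self s
    linarith
  intro s s' hs hs'
  refine sign_const_of_ne (Polynomial.continuous _) fun x hx => hroot x ?_
  rcases Set.mem_uIcc.1 hx with h | h
  · exact hs.trans_le h.1
  · exact hs'.trans_le h.1

theorem IsPolyFn.exists_poly1 {f : ℝ → ℝ} (hf : IsPolyFn f) : ∃ a : ℝ[X], ∀ R, f R = a.eval R := by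
  induction hf using Algebra.adjoin_induction with
  | mem f hf =>
    refine ⟨C (f 1) * X, fun R => ?_⟩
    have := hf.map_smul R 1
    simp only [smul_eq_mul, mul_one] at this
    rw [this]; simp only [eval_mul, eval_C, eval_X]; ring
  | algebraMap r => exact ⟨C r, fun x => by simp⟩
  | add f g _ _ h1 h2 =>
    obtain ⟨P, hP⟩ := h1
    obtain ⟨Q, hQ⟩ := h2
    exact ⟨P + Q, fun x => by simp [hP, hQ]⟩
  | mul f g _ _ h1 h2 =>
    obtain ⟨P, hP⟩ := h1
    obtain ⟨Q, hQ⟩ := h2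
    exact ⟨P * Q, fun x => by simp [hP, hQ]⟩

theorem IsPolyFn.exists_poly2 {f : ℝ × ℝ → ℝ} (hf : IsPolyFn f) :
    ∃ P : ℝ[X][X], ∀ R s, f (R, s) = (P.map (evalRingHom R)).eval s := by
  induction hf using Algebra.adjoin_induction with
  | mem f hf =>
    refine ⟨C (C (f (1, 0)) * X) + C (C (f (0, 1))) * X, fun R s => ?_⟩
    have e : (R, s) = R • ((1:ℝ), (0:ℝ)) + s • ((0:ℝ), (1:ℝ)) := by simp
    rw [e, hf.map_add, hf.map_smul, hf.map_smul]
    simp only [Polynomial.map_add, Polynomial.map_mul, map_C, map_X, eval_add, eval_mul, eval_C, eval_X, coe_evalRingHom, smul_eq_mul]; ring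
  | algebraMap r => exact ⟨C (C r), fun x s => by simp⟩
  | add f g _ _ h1 h2 =>
    obtain ⟨P, hP⟩ := h1
    obtain ⟨Q, hQ⟩ := h2
    exact ⟨P + Q, fun x s => by simp [hP, hQ]⟩
  | mul f g _ _ h1 h2 =>
    obtain ⟨P, hP⟩ := h1
    obtain ⟨Q, hQ⟩ := h2
    exact ⟨P * Q, fun x s => by simp [hP, hQ]⟩

theorem SA.growth {S : ℝ → ℝ → Prop} (hS : SA {q : ℝ × ℝ | S q.1 q.2})
    (hb : ∀ R, ∃ M, ∀ s, S R s → s ≤ M) (hm : ∀ R R' s, R ≤ R' → S R s → S R' s) :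
    ∃ (K : ℝ) (N : ℕ), 0 < K ∧ ∀ R, 1 ≤ R → ∀ s, S R s → s ≤ K * R ^ N := by
  classical
  obtain ⟨D, hD, h⟩ := hS
  have h1 : ∀ f : ℝ × ℝ → ℝ, ∃ (K : ℝ) (N : ℕ) (R0 : ℝ), 0 ≤ K ∧ 1 ≤ R0 ∧ (f ∈ D →
      ∀ R, R0 ≤ R → ∀ s s', K * R ^ N < s → K * R ^ N < s' →
      SignType.sign (f (R, s)) = SignType.sign (f (R, s'))) := by
    intro f
    by_cases hf : f ∈ D
    · obtain ⟨P, hP⟩ := (hD f hf).exists_poly2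
      obtain ⟨K, N, R0, h1, h2, h3⟩ := sign_eventually P
      exact ⟨K, N, R0, h1, h2, fun _ => by simpa only [hP] using h3⟩
    · exact ⟨0, 0, 1, le_rfl, le_rfl, fun h => absurd h hf⟩
  choose K N R0 hK hR0 hs using h1
  set KK := ∑ f ∈ D, K f + 1 with hKK
  set NN := ∑ f ∈ D, N f with hNN
  set RR := ∑ f ∈ D, R0 f + 1 with hRR
  have hKK0 : 0 < KK := add_pos_of_nonneg_of_pos (Finset.sum_nonneg fun i _ => hK i) one_pos
  have hRR1 : 1 ≤ RR := le_add_of_nonneg_left (Finset.sum_nonneg fun i _ => zero_le_one.trans (hR0 i))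
  have main : ∀ R, RR ≤ R → ∀ s, S R s → s ≤ KK * R ^ NN := by
    intro R hR s hsS
    by_contra hlt
    push Not at hlt
    have hR1 : 1 ≤ R := hRR1.trans hR
    obtain ⟨M, hM⟩ := hb R
    have h2 : S R (max s (M + 1)) := by
      refine h (R, s) (R, max s (M + 1)) (fun f hf => ?_) hsS
      have h3 : K f * R ^ N f ≤ KK * R ^ NN := by
        refine mul_le_mul ?_ (pow_le_pow_right₀ hR1 ?_) (by positivity) hKK0.le
        · have := Finset.single_le_sum (f := K) (fun j _ => hK j) hf
          linarith
        · exact Finset.single_le_sum (f := N) (fun j _ => Nat.zero_le _) hf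
      have h4 : R0 f ≤ R := by
        have := Finset.single_le_sum (f := R0) (fun j _ => zero_le_one.trans (hR0 j)) hf
        linarith
      exact hs f hf R h4 _ _ (h3.trans_lt hlt) ((h3.trans_lt hlt).trans_le (le_max_left _ _))
    have := hM _ h2
    have := le_max_right s (M + 1)
    linarith
  refine ⟨KK * RR ^ NN, NN, by positivity, fun R hR s hsS => ?_⟩
  have h5 : (1:ℝ) ≤ RR ^ NN := one_le_pow₀ hRR1
  have h6 : (1:ℝ) ≤ R ^ NN := one_le_pow₀ hR
  by_cases hRR : RR ≤ R
  · refine (main R hRR s hsS).trans ?_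
    refine mul_le_mul_of_nonneg_right (le_mul_of_one_le_right hKK0.le h5) (by positivity)
  · push Not at hRR
    refine (main RR le_rfl s (hm _ _ _ hRR.le hsS)).trans ?_
    exact le_mul_of_one_le_right (by positivity) h6
end part5

section part6
/-! ### Semialgebraic to SA -/
section connect

theorem IsPolyFn.mvpoly {n : ℕ} (p : MvPolynomial (Fin n) ℝ) :
    IsPolyFn (fun x : Fin n → ℝ => MvPolynomial.eval x p) := by
  induction p using MvPolynomial.induction_on with
  | C a => simpa using IsPolyFn.const a
  | add p q hp hq => simpa using hp.add hq
  | mul_X p i hp =>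
    have : IsPolyFn (fun x : Fin n → ℝ => x i) := IsPolyFn.lin ⟨fun _ _ => rfl, fun _ _ => rfl⟩
    simpa using hp.mul this

theorem IsSemialgebraic.sa {n : ℕ} {S : Set (Fin n → ℝ)} (h : IsSemialgebraic S) : SA S := by
  obtain ⟨m, p, Q, rfl⟩ := h
  have : SA {x : Fin n → ℝ | ∃ i, MvPolynomial.eval x (p i) = 0 ∧
      ∀ q ∈ Q i, 0 < MvPolynomial.eval x q} :=
    SA.exFin fun i => (SA.eq (IsPolyFn.mvpoly _) (IsPolyFn.const 0)).and
      (SA.allFinset _ fun q _ => SA.pos (IsPolyFn.mvpoly q))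
  convert this using 1
  ext x; simp

end connect

section weight
variable {n m : ℕ}

/-- Compact exhaustion. -/
def KR (U : Set (Fin n → ℝ)) (R : ℝ) : Set (Fin n → ℝ) :=
  {x | ‖x‖ ≤ R ∧ ∀ z ∈ Uᶜ, 1 ≤ R * ‖x - z‖}

theorem KR_sub (U : Set (Fin n → ℝ)) (R : ℝ) : KR U R ⊆ U := by
  intro x hx
  by_contra h
  have := hx.2 x h
  simp at this
  linarith

theorem KR_compact (U : Set (Fin n → ℝ)) (R : ℝ) : IsCompact (KR U R) := by
  refine Metric.isCompact_of_isClosed_isBounded ?_ ?_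
  · have : KR U R = {x | ‖x‖ ≤ R} ∩ ⋂ z ∈ Uᶜ, {x | 1 ≤ R * ‖x - z‖} := by
      ext x; simp [KR]
    rw [this]
    refine (isClosed_le (by fun_prop) (by fun_prop)).inter
      (isClosed_biInter fun z _ => isClosed_le (by fun_prop) (by fun_prop))
  · exact (Metric.isBounded_closedBall (x := (0 : Fin n → ℝ)) (r := R)).subset
      (fun x hx => by simpa using hx.1)

theorem KR_mono (U : Set (Fin n → ℝ)) {R R' : ℝ} (h : R ≤ R') : KR U R ⊆ KR U R' :=
  fun x hx => ⟨hx.1.trans h, fun z hz => (hx.2 z hz).trans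
    (mul_le_mul_of_nonneg_right h (norm_nonneg _))⟩

open Classical in
/-- The weight function. -/
noncomputable def wt (U : Set (Fin n → ℝ)) (x : Fin n → ℝ) : ℝ :=
  min ((1 + ‖x‖)⁻¹) (if U = Set.univ then 1 else Metric.infDist x Uᶜ)

variable {U : Set (Fin n → ℝ)} {x y z : Fin n → ℝ}

theorem wt_nonneg : 0 ≤ wt U x := by
  refine le_min (by positivity) ?_
  split_ifs
  · exact zero_le_one
  · exact Metric.infDist_nonneg

theorem wt_le_norm : wt U x ≤ (1 + ‖x‖)⁻¹ := min_le_left _ _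

theorem wt_le_one : wt U x ≤ 1 :=
  wt_le_norm.trans (inv_le_one_of_one_le₀ (by linarith [norm_nonneg x]))

theorem wt_le_dist (hz : z ∉ U) : wt U x ≤ ‖x - z‖ := by
  have : U ≠ Set.univ := fun h => hz (h ▸ Set.mem_univ _)
  refine (min_le_right _ _).trans ?_
  rw [if_neg this, ← dist_eq_norm]
  exact Metric.infDist_le_dist_of_mem hz

theorem le_wt {r : ℝ} (h1 : r * (1 + ‖x‖) ≤ 1) (h : ∀ z ∉ U, r ≤ ‖x - z‖) : r ≤ wt U x := by
  refine le_min ?_ ?_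
  · rw [inv_eq_one_div, le_div_iff₀ (by positivity)]; exact h1
  · split_ifs with hU
    · nlinarith [norm_nonneg x]
    · have : (Uᶜ).Nonempty := Set.nonempty_compl.2 hU
      rw [Metric.le_infDist this]
      intro z hz
      rw [dist_eq_norm]
      exact h z hz

theorem wt_zero (h : x ∉ U) : wt U x = 0 :=
  le_antisymm ((wt_le_dist h).trans (by simp)) wt_nonneg

theorem wt_lip : wt U x ≤ wt U y + ‖x - y‖ := by
  unfold wt
  rw [← min_add_add_right]
  refine min_le_min ?_ ?_
  · have h1 : ‖y‖ ≤ ‖x‖ + ‖x - y‖ := by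
      have := norm_sub_norm_le y x
      rw [norm_sub_rev] at this; linarith
    have hx := norm_nonneg x
    have hy := norm_nonneg y
    rw [inv_eq_one_div, inv_eq_one_div, div_add' _ _ _ (by positivity), div_le_div_iff₀ (by positivity) (by positivity)]
    nlinarith [norm_nonneg (x - y), mul_nonneg hx hy, mul_nonneg hx (norm_nonneg (x - y)), mul_nonneg hy (norm_nonneg (x - y)), mul_nonneg (mul_nonneg hx hy) (norm_nonneg (x - y))]
  · split_ifs
    · linarith [norm_nonneg (x - y)]
    · rw [← dist_eq_norm]
      exact Metric.infDist_le_infDist_add_dist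

theorem wt_pos (hU : IsOpen U) (hx : x ∈ U) : 0 < wt U x := by
  refine lt_min (by positivity) ?_
  split_ifs with h
  · exact one_pos
  · have hne : (Uᶜ).Nonempty := Set.nonempty_compl.2 h
    rw [← IsClosed.notMem_iff_infDist_pos hU.isClosed_compl hne]
    simpa using hx

theorem wt_cont : Continuous (wt U) := by
  have : LipschitzWith 1 (wt U) := LipschitzWith.of_le_add fun x y => by
    rw [dist_eq_norm]; exact wt_lip
  exact this.continuous

theorem mem_KR (hU : IsOpen U) (hx : x ∈ U) : x ∈ KR U (wt U x)⁻¹ := by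
  have hw := wt_pos hU hx
  refine ⟨?_, fun z hz => ?_⟩
  · have := (le_inv_comm₀ hw (by positivity)).1 (wt_le_norm (U := U) (x := x))
    linarith
  · rw [inv_mul_eq_div, one_le_div hw]
    exact wt_le_dist hz

theorem one_le_wt_inv (hU : IsOpen U) (hx : x ∈ U) : 1 ≤ (wt U x)⁻¹ :=
  (one_le_inv₀ (wt_pos hU hx)).2 wt_le_one

theorem SA.normLe {E : Type} [AddCommGroup E] [Module ℝ E] {f : E → Fin n → ℝ} {R : E → ℝ}
    (hf : ∀ i, IsPolyFn (fun x => f x i)) (hR : IsPolyFn R) : SA {x | ‖f x‖ ≤ R x} := by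
  have : SA {x | 0 ≤ R x ∧ ∀ i, f x i ≤ R x ∧ - f x i ≤ R x} :=
    (SA.le (IsPolyFn.const 0) hR).and (SA.allFin fun i => (SA.le (hf i) hR).and (SA.le (hf i).neg hR))
  convert this using 3 with x
  constructor
  · intro h
    refine ⟨(norm_nonneg _).trans h, fun i => ?_⟩
    have := (norm_le_pi_norm (f x) i).trans h
    rw [Real.norm_eq_abs, abs_le] at this
    constructor <;> linarith
  · rintro ⟨h0, h⟩
    rw [pi_norm_le_iff_of_nonneg h0]
    intro i
    rw [Real.norm_eq_abs, abs_le]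
    constructor <;> linarith [h i]

theorem SA.mulNormLe {E : Type} [AddCommGroup E] [Module ℝ E] {f : E → Fin n → ℝ} {R : E → ℝ}
    (hf : ∀ i, IsPolyFn (fun x => f x i)) (hR : IsPolyFn R) : SA {x | 1 ≤ R x * ‖f x‖} := by
  have : SA {x | 0 ≤ R x ∧ ¬ (∀ i, R x * f x i < 1 ∧ R x * -f x i < 1)} :=
    (SA.le (IsPolyFn.const 0) hR).and (SA.not (SA.allFin fun i => (SA.lt (hR.mul (hf i)) (IsPolyFn.const 1)).and (SA.lt (hR.mul (hf i).neg) (IsPolyFn.const 1))))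
  convert this using 3 with x
  constructor
  · intro h
    have h0 : 0 ≤ R x := by
      by_contra h0; push Not at h0
      nlinarith [norm_nonneg (f x)]
    refine ⟨h0, fun h1 => ?_⟩
    have : ‖R x • f x‖ < 1 := by
      rw [pi_norm_lt_iff one_pos]
      intro i
      rw [Real.norm_eq_abs, abs_lt]
      have := h1 i
      simp only [Pi.smul_apply, smul_eq_mul]
      constructor <;> linarith
    rw [norm_smul, Real.norm_of_nonneg h0] at this
    linarith
  · rintro ⟨h0, h⟩
    by_contra h1
    push Not at h1
    refine h fun i => ?_
    have h2 := norm_le_pi_norm (R x • f x) i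
    rw [norm_smul, Real.norm_of_nonneg h0] at h2
    have := h2.trans_lt h1
    rw [Real.norm_eq_abs, abs_lt] at this
    simp only [Pi.smul_apply, smul_eq_mul] at this
    constructor <;> linarith

theorem growthU (hU : IsOpen U) (hUs : SA U) {T : (Fin n → ℝ) → ℝ → Prop}
    (hT : SA {q : (Fin n → ℝ) × ℝ | T q.1 q.2})
    (hb : ∀ R, ∃ M, ∀ x ∈ KR U R, ∀ s, T x s → s ≤ M) :
    ∃ (K : ℝ) (N : ℕ), 0 < K ∧ ∀ x ∈ U, ∀ s, T x s → s ≤ K * (wt U x)⁻¹ ^ N := by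
  have h := SA.growth (S := fun R s => ∃ x, (‖x‖ ≤ R ∧ ∀ z, z ∈ Uᶜ → 1 ≤ R * ‖x - z‖) ∧ T x s) ?_ ?_ ?_
  · obtain ⟨K, N, hK, h⟩ := h
    exact ⟨K, N, hK, fun x hx s hs => h _ (one_le_wt_inv hU hx) s ⟨x, mem_KR hU hx, hs⟩⟩
  · refine SA.exV (SA.and (SA.and ?_ ?_) ?_)
    · exact SA.normLe (fun i => IsPolyFn.lin ⟨fun _ _ => rfl, fun _ _ => rfl⟩)
        (IsPolyFn.lin ⟨fun _ _ => rfl, fun _ _ => rfl⟩)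
    · refine SA.allV (SA.imp ?_ ?_)
      · exact SA.not (hUs.comp ⟨fun _ _ => rfl, fun _ _ => rfl⟩)
      · refine SA.mulNormLe (fun i => IsPolyFn.lin ⟨fun _ _ => ?_, fun _ _ => ?_⟩)
          (IsPolyFn.lin ⟨fun _ _ => rfl, fun _ _ => rfl⟩)
        · simp; ring
        · simp; ring
    · exact hT.comp (g := fun q : (ℝ × ℝ) × (Fin n → ℝ) => (q.2, q.1.2)) ⟨fun _ _ => rfl, fun _ _ => rfl⟩
  · intro R
    obtain ⟨M, hM⟩ := hb R
    exact ⟨M, fun s ⟨x, hx, hs⟩ => hM x hx s hs⟩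
  · rintro R R' s hR ⟨x, hx, hs⟩
    exact ⟨x, KR_mono U hR hx, hs⟩

end weight
end part6

section part7
section nash
variable {n m : ℕ} {U : Set (Fin n → ℝ)}

theorem SA.sub2 {E F : Type} [AddCommGroup E] [Module ℝ E] [AddCommGroup F] [Module ℝ F]
    {G : E → ℝ → Prop} (hG : SA {q : E × ℝ | G q.1 q.2}) {f : F → E} {l : F → ℝ}
    (hf : IsLinearMap ℝ f) (hl : IsLinearMap ℝ l) : SA {x | G (f x) (l x)} :=
  hG.comp (g := fun x => (f x, l x)) ⟨fun x y => by simp [hf.map_add, hl.map_add],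
    fun c x => by simp [hf.map_smul, hl.map_smul]⟩

/-- scalar Nash functions -/
structure NashFn (U : Set (Fin n → ℝ)) (h : (Fin n → ℝ) → ℝ) : Prop where
  smooth : ContDiffOn ℝ (⊤ : ℕ∞) h U
  sa : SA {q : (Fin n → ℝ) × ℝ | q.1 ∈ U ∧ h q.1 = q.2}

theorem NashFn.pd (hU : IsOpen U) (hUs : SA U) {h : (Fin n → ℝ) → ℝ} (hh : NashFn U h) (i : Fin n) :
    NashFn U (fun x => fderiv ℝ h x (Pi.single i 1)) := by
  refine ⟨?_, ?_⟩
  · exact (hh.smooth.fderiv_of_isOpen hU (by simp)).clm_apply contDiffOn_const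
  have key : SA {q : (Fin n → ℝ) × ℝ | q.1 ∈ U ∧ ∀ ε : ℝ, 0 < ε → ∃ δ : ℝ, 0 < δ ∧
      ∀ t : ℝ, -δ < t → t < δ → ∀ a : ℝ, (q.1 + t • Pi.single i (1:ℝ) ∈ U ∧ h (q.1 + t • Pi.single i (1:ℝ)) = a) →
        ∀ b : ℝ, (q.1 ∈ U ∧ h q.1 = b) → (a - b - t * q.2) ^ 2 ≤ (ε * t) ^ 2} := by
    refine SA.and (hUs.comp ⟨fun _ _ => rfl, fun _ _ => rfl⟩) ?_
    refine SA.all (SA.imp ?_ (SA.ex (SA.and ?_ (SA.all (SA.imp ?_ (SA.imp ?_ (SA.all (SA.imp ?_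
      (SA.all (SA.imp ?_ ?_))))))))))
    · exact SA.lt (IsPolyFn.const 0) (IsPolyFn.lin ⟨fun _ _ => rfl, fun _ _ => rfl⟩)
    · exact SA.lt (IsPolyFn.const 0) (IsPolyFn.lin ⟨fun _ _ => rfl, fun _ _ => rfl⟩)
    · exact SA.lt (IsPolyFn.neg (IsPolyFn.lin ⟨fun _ _ => rfl, fun _ _ => rfl⟩)) (IsPolyFn.lin ⟨fun _ _ => rfl, fun _ _ => rfl⟩)
    · exact SA.lt (IsPolyFn.lin ⟨fun _ _ => rfl, fun _ _ => rfl⟩) (IsPolyFn.lin ⟨fun _ _ => rfl, fun _ _ => rfl⟩)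
    · refine SA.sub2 (G := fun x t => x ∈ U ∧ h x = t) hh.sa ⟨fun x y => ?_, fun c x => ?_⟩ ⟨fun _ _ => rfl, fun _ _ => rfl⟩
      · ext j; simp; ring
      · ext j; simp; ring
    · exact SA.sub2 (G := fun x t => x ∈ U ∧ h x = t) hh.sa ⟨fun _ _ => rfl, fun _ _ => rfl⟩ ⟨fun _ _ => rfl, fun _ _ => rfl⟩
    · simp only [pow_two]
      have l1 : ∀ {l : ((((((Fin n → ℝ) × ℝ) × ℝ) × ℝ) × ℝ) × ℝ) × ℝ → ℝ}, IsLinearMap ℝ l → IsPolyFn l :=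
        fun h => IsPolyFn.lin h
      have p1 := ((l1 (l := fun x => x.1.2) ⟨fun _ _ => rfl, fun _ _ => rfl⟩).sub
          (l1 (l := fun x => x.2) ⟨fun _ _ => rfl, fun _ _ => rfl⟩)).sub
          ((l1 (l := fun x => x.1.1.2) ⟨fun _ _ => rfl, fun _ _ => rfl⟩).mul
          (l1 (l := fun x => x.1.1.1.1.1.2) ⟨fun _ _ => rfl, fun _ _ => rfl⟩))
      have p2 := (l1 (l := fun x => x.1.1.1.1.2) ⟨fun _ _ => rfl, fun _ _ => rfl⟩).mul
        (l1 (l := fun x => x.1.1.2) ⟨fun _ _ => rfl, fun _ _ => rfl⟩)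
      exact SA.le (p1.mul p1) (p2.mul p2)
  convert key using 3 with q
  refine and_congr_right fun hq => ?_
  have hd : HasFDerivAt h (fderiv ℝ h q.1) q.1 :=
    ((hh.smooth.contDiffAt (hU.mem_nhds hq)).differentiableAt (by simp)).hasFDerivAt
  have hline : HasDerivAt (fun t : ℝ => q.1 + t • (Pi.single i (1:ℝ) : Fin n → ℝ)) (Pi.single i 1) 0 := by
    simpa using ((hasDerivAt_id (0:ℝ)).smul_const (Pi.single i (1:ℝ) : Fin n → ℝ)).const_add q.1
  have hd2 : HasDerivAt (fun t : ℝ => h (q.1 + t • (Pi.single i (1:ℝ) : Fin n → ℝ))) (fderiv ℝ h q.1 (Pi.single i 1)) 0 := by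
    refine HasFDerivAt.comp_hasDerivAt (0:ℝ) ?_ hline
    simpa using hd
  have hev : ∀ᶠ t in nhds (0:ℝ), q.1 + t • (Pi.single i (1:ℝ) : Fin n → ℝ) ∈ U := by
    refine hline.continuousAt.eventually (hU.mem_nhds ?_)
    simpa using hq
  have sqi : ∀ (a b d t ε : ℝ), 0 < ε → ((a - b - t * d) ^ 2 ≤ (ε * t) ^ 2 ↔ ‖a - b - (t - 0) • d‖ ≤ ε * ‖t - 0‖) := by
    intro a b d t ε hε
    rw [sq_le_sq, abs_mul, abs_of_pos hε]
    simp
  have hd3 : (fderiv ℝ h q.1 (Pi.single i 1) = q.2) ↔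
      HasDerivAt (fun t : ℝ => h (q.1 + t • (Pi.single i (1:ℝ) : Fin n → ℝ))) q.2 0 :=
    ⟨fun e => e ▸ hd2, fun e => hd2.unique e⟩
  rw [hd3, hasDerivAt_iff_isLittleO, Asymptotics.isLittleO_iff]
  constructor
  · intro H ε hε
    obtain ⟨δ, hδ, hb⟩ := Metric.eventually_nhds_iff.1 (H hε)
    refine ⟨δ, hδ, fun t h1 h2 a ha b hb' => ?_⟩
    have := hb (y := t) (by rw [Real.dist_eq, abs_lt]; constructor <;> linarith)
    rw [sqi _ _ _ _ _ hε, ← ha.2, ← hb'.2]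
    simpa using this
  · intro H ε hε
    obtain ⟨δ, hδ, hb⟩ := H ε hε
    filter_upwards [hev, Metric.ball_mem_nhds (0:ℝ) hδ] with t ht htb
    rw [Metric.mem_ball, Real.dist_eq, abs_lt] at htb
    have := hb t (by linarith) (by linarith) _ ⟨ht, rfl⟩ _ ⟨hq, rfl⟩
    rw [sqi _ _ _ _ _ hε] at this
    simpa using this

/-- polynomially bounded -/
def PB {F : Type*} [NormedAddCommGroup F] (U : Set (Fin n → ℝ)) (f : (Fin n → ℝ) → F) : Prop :=
  ∃ (K : ℝ) (N : ℕ), 0 < K ∧ ∀ x ∈ U, ‖f x‖ ≤ K * (wt U x)⁻¹ ^ N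

theorem NashFn.pb (hU : IsOpen U) (hUs : SA U) {h : (Fin n → ℝ) → ℝ} (hh : NashFn U h) : PB U h := by
  have := growthU hU hUs (T := fun x s => (x ∈ U ∧ h x = s) ∨ (x ∈ U ∧ h x = -s)) ?_ ?_
  · obtain ⟨K, N, hK, H⟩ := this
    refine ⟨K, N, hK, fun x hx => ?_⟩
    rw [Real.norm_eq_abs, abs_le']
    exact ⟨H x hx _ (Or.inl ⟨hx, rfl⟩), H x hx _ (Or.inr ⟨hx, by simp⟩)⟩
  · refine SA.or hh.sa (SA.sub2 (G := fun x t => x ∈ U ∧ h x = t) hh.sa ⟨fun _ _ => rfl, fun _ _ => rfl⟩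
      ⟨fun x y => ?_, fun c x => ?_⟩)
    · simp; ring
    · simp
  · intro R
    have := (KR_compact U R).exists_bound_of_continuousOn (hh.smooth.continuousOn.mono (KR_sub U R))
    obtain ⟨M, hM⟩ := this
    refine ⟨M, fun x hx s hs => ?_⟩
    have h1 := hM x hx
    rw [Real.norm_eq_abs, abs_le] at h1
    rcases hs with hs | hs <;> linarith

variable {F : Type*} [NormedAddCommGroup F]

theorem PB.mono {f : (Fin n → ℝ) → F} {f' : (Fin n → ℝ) → ℝ} (hf' : PB U f')
    (h : ∀ x ∈ U, ‖f x‖ ≤ f' x) : PB U f := by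
  obtain ⟨K, N, hK, H⟩ := hf'
  exact ⟨K, N, hK, fun x hx => ((h x hx).trans (Real.le_norm_self _)).trans (H x hx)⟩

theorem PB.norm {f : (Fin n → ℝ) → F} (hf : PB U f) : PB U (fun x => ‖f x‖) := by
  simpa [PB] using hf

theorem PB.const (c : F) : PB U (fun _ => c) :=
  ⟨‖c‖ + 1, 0, by positivity, fun x hx => by simp⟩

theorem PB.add (hU : IsOpen U) {f g : (Fin n → ℝ) → ℝ} (hf : PB U f) (hg : PB U g) :
    PB U (fun x => f x + g x) := by
  obtain ⟨K, N, hK, H⟩ := hf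
  obtain ⟨K', N', hK', H'⟩ := hg
  refine ⟨K + K', N + N', by positivity, fun x hx => (norm_add_le _ _).trans ?_⟩
  have h1 := one_le_wt_inv hU hx
  rw [add_mul]
  refine add_le_add ((H x hx).trans ?_) ((H' x hx).trans ?_)
  · gcongr
    omega
  · gcongr
    omega

theorem PB.mul {f g : (Fin n → ℝ) → ℝ} (hf : PB U f) (hg : PB U g) :
    PB U (fun x => f x * g x) := by
  obtain ⟨K, N, hK, H⟩ := hf
  obtain ⟨K', N', hK', H'⟩ := hg
  refine ⟨K * K', N + N', by positivity, fun x hx => ?_⟩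
  rw [norm_mul, pow_add, mul_mul_mul_comm]
  have := wt_nonneg (U := U) (x := x)
  exact mul_le_mul (H x hx) (H' x hx) (norm_nonneg _) (by positivity)

theorem PB.sum (hU : IsOpen U) {ι : Type*} (s : Finset ι) {f : ι → (Fin n → ℝ) → ℝ} (hf : ∀ i ∈ s, PB U (f i)) :
    PB U (fun x => ∑ i ∈ s, f i x) := by
  classical
  induction s using Finset.induction_on with
  | empty => simpa using PB.const (0:ℝ)
  | insert a s ha ih =>
    simp only [Finset.sum_insert ha]
    exact PB.add hU (hf a (by simp)) (ih fun i hi => hf i (by simp [hi]))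

variable [NormedSpace ℝ F]

theorem PB.clmSum (hU : IsOpen U) {ι : Type*} [Fintype ι] (L : ι → ℝ →L[ℝ] F) {h : ι → (Fin n → ℝ) → ℝ}
    (hs : ∀ i, ContDiffOn ℝ (⊤ : ℕ∞) (h i) U) (k : ℕ) (hk : ∀ i, PB U (iteratedFDeriv ℝ k (h i))) :
    PB U (iteratedFDeriv ℝ k (fun x => ∑ i, L i (h i x))) := by
  refine PB.mono (PB.sum hU Finset.univ (fun i _ => (PB.const ‖L i‖).mul (hk i).norm)) ?_
  intro x hx
  have hc : ∀ i, ContDiffAt ℝ k (h i) x := fun i => 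
    ((hs i).contDiffAt (hU.mem_nhds hx)).of_le (by exact_mod_cast le_top)
  have := iteratedFDeriv_sum_apply (𝕜 := ℝ) (f := fun i x => L i (h i x)) (u := Finset.univ) (n := k) (x := x)
    (fun i _ => (L i).contDiff.contDiffAt.comp x (hc i))
  have e : (fun x => ∑ i, L i (h i x)) = ∑ i, fun x => L i (h i x) := by
    funext x; simp
  rw [e, this]
  refine (norm_sum_le _ _).trans (Finset.sum_le_sum fun i _ => ?_)
  exact (L i).norm_iteratedFDeriv_comp_left (hc i) le_rfl

theorem NashFn.pbk (hU : IsOpen U) (hUs : SA U) (k : ℕ) {h : (Fin n → ℝ) → ℝ} (hh : NashFn U h) :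
    PB U (iteratedFDeriv ℝ k h) := by
  induction k generalizing h with
  | zero =>
    refine PB.mono (hh.pb hU hUs).norm fun x hx => ?_
    rw [norm_iteratedFDeriv_zero]
  | succ k ih =>
    have h1 : fderiv ℝ h = fun x => ∑ i, (ContinuousLinearMap.toSpanSingleton ℝ
      (ContinuousLinearMap.proj (R := ℝ) (φ := fun _ : Fin n => ℝ) i)) (fderiv ℝ h x (Pi.single i 1)) := by
      funext x
      ext v
      conv_lhs => rw [pi_eq_sum_univ' v]
      simp [mul_comm]
    have h2 : PB U (iteratedFDeriv ℝ k (fderiv ℝ h)) := by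
      rw [h1]
      exact PB.clmSum hU _ (fun i => (hh.pd hU hUs i).smooth) k (fun i => ih (hh.pd hU hUs i))
    refine PB.mono h2.norm fun x hx => ?_
    rw [norm_iteratedFDeriv_fderiv]

theorem IsNashMap.sa {g : (Fin n → ℝ) → (Fin m → ℝ)} (hg : IsNashMap U g) :
    SA {q : (Fin n → ℝ) × (Fin m → ℝ) | q.1 ∈ U ∧ g q.1 = q.2} := by
  have := hg.2.sa.comp (g := fun q : (Fin n → ℝ) × (Fin m → ℝ) => (Fin.append q.1 q.2 : Fin (n+m) → ℝ))
    ⟨fun x y => ?_, fun c x => ?_⟩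
  · convert this using 3 with q
    simp [funext_iff]
  · ext i
    refine Fin.addCases (fun i => ?_) (fun i => ?_) i <;> simp
  · ext i
    refine Fin.addCases (fun i => ?_) (fun i => ?_) i <;> simp

theorem IsNashMap.coord {g : (Fin n → ℝ) → (Fin m → ℝ)} (hg : IsNashMap U g) (j : Fin m) :
    NashFn U (fun x => g x j) := by
  refine ⟨contDiffOn_pi.1 hg.1 j, ?_⟩
  have : SA {q : (Fin n → ℝ) × ℝ | ∃ v : Fin m → ℝ, (q.1 ∈ U ∧ g q.1 = v) ∧ v j = q.2} := by
    refine SA.exV (SA.and ?_ ?_)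
    · exact hg.sa.comp (g := fun q : ((Fin n → ℝ) × ℝ) × (Fin m → ℝ) => (q.1.1, q.2)) ⟨fun _ _ => rfl, fun _ _ => rfl⟩
    · exact SA.eq (IsPolyFn.lin ⟨fun _ _ => rfl, fun _ _ => rfl⟩) (IsPolyFn.lin ⟨fun _ _ => rfl, fun _ _ => rfl⟩)
  convert this using 3 with q
  simp [and_assoc]

theorem IsNashMap.pbk (hU : IsOpen U) (hUs : SA U) (k : ℕ) {g : (Fin n → ℝ) → (Fin m → ℝ)}
    (hg : IsNashMap U g) : PB U (iteratedFDeriv ℝ k g) := by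
  have h1 : g = fun x => ∑ j, (ContinuousLinearMap.toSpanSingleton ℝ (Pi.single j (1:ℝ) : Fin m → ℝ)) (g x j) := by
    funext x
    conv_lhs => rw [pi_eq_sum_univ' (g x)]
    simp
  rw [h1]
  exact PB.clmSum hU _ (fun j => (hg.coord j).smooth) k (fun j => (hg.coord j).pbk hU hUs k)

end nash
end part7

section part8
section wtcomp
variable {n m : ℕ}

/-- lower bound for the weight along a Nash map. -/
theorem wt_comp {U X : Set (Fin n → ℝ)} {W : Set (Fin m → ℝ)} {g : (Fin n → ℝ) → (Fin m → ℝ)}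
    (hU : IsOpen U) (hUs : SA U) (hW : IsOpen W) (hWs : SA W) (hXs : SA X) (hXU : X ⊆ U)
    (hXc : ∃ C, IsClosed C ∧ X = U ∩ C)
    (hg : IsNashMap U g) (hgX : ∀ x ∈ X, g x ∈ W) :
    ∃ (K : ℝ) (N : ℕ), 0 < K ∧ ∀ x ∈ X, (wt W (g x))⁻¹ ≤ K * (wt U x)⁻¹ ^ N := by
  have := growthU hU hUs (T := fun x s => x ∈ X ∧ ∃ y : Fin m → ℝ, (x ∈ U ∧ g x = y) ∧
    ((∃ i, s ≤ y i ∨ s ≤ - y i) ∨ ∃ z : Fin m → ℝ, z ∉ W ∧ ∀ i, s * (y i - z i) ≤ 1 ∧ s * - (y i - z i) ≤ 1)) ?_ ?_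
  · obtain ⟨K, N, hK, H⟩ := this
    refine ⟨1 + K, N, by positivity, fun x hx => ?_⟩
    have hw := wt_pos hW (hgX x hx)
    have h1 := one_le_pow₀ (n := N) (one_le_wt_inv hU (hXU hx))
    set r := (wt U x)⁻¹ ^ N with hr
    rw [inv_le_comm₀ hw (by positivity)]
    have hn : ‖g x‖ ≤ K * r := by
      rw [pi_norm_le_iff_of_nonneg (by positivity)]
      intro i
      rw [Real.norm_eq_abs, abs_le']
      exact ⟨H x (hXU hx) _ ⟨hx, g x, ⟨hXU hx, rfl⟩, Or.inl ⟨i, Or.inl le_rfl⟩⟩,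
        H x (hXU hx) _ ⟨hx, g x, ⟨hXU hx, rfl⟩, Or.inl ⟨i, Or.inr le_rfl⟩⟩⟩
    refine le_wt ?_ fun z hz => ?_
    · rw [inv_mul_le_one₀ (by positivity)]
      nlinarith
    · have hp : 0 < ‖g x - z‖ := hw.trans_le (wt_le_dist hz)
      have h2 := H x (hXU hx) (‖g x - z‖⁻¹) ⟨hx, g x, ⟨hXU hx, rfl⟩, Or.inr ⟨z, hz, fun i => ?_⟩⟩
      · rw [inv_le_comm₀ (by positivity) hp]
        nlinarith
      · have := norm_le_pi_norm (g x - z) i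
        rw [Real.norm_eq_abs, abs_le'] at this
        rw [inv_mul_le_one₀ hp, inv_mul_le_one₀ hp]
        exact this
  · refine SA.and (hXs.comp ⟨fun _ _ => rfl, fun _ _ => rfl⟩) (SA.exV (SA.and ?_ (SA.or ?_ (SA.exV (SA.and ?_ ?_)))))
    · exact hg.sa.comp (g := fun q : ((Fin n → ℝ) × ℝ) × (Fin m → ℝ) => (q.1.1, q.2)) ⟨fun _ _ => rfl, fun _ _ => rfl⟩
    · refine SA.exFin fun i => SA.or (SA.le (IsPolyFn.lin ⟨fun _ _ => rfl, fun _ _ => rfl⟩) (IsPolyFn.lin ⟨fun _ _ => rfl, fun _ _ => rfl⟩))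
        (SA.le (IsPolyFn.lin ⟨fun _ _ => rfl, fun _ _ => rfl⟩) (IsPolyFn.neg (IsPolyFn.lin ⟨fun _ _ => rfl, fun _ _ => rfl⟩)))
    · exact SA.not (hWs.comp ⟨fun _ _ => rfl, fun _ _ => rfl⟩)
    · refine SA.allFin fun i => ?_
      have l1 : ∀ {l : (((Fin n → ℝ) × ℝ) × (Fin m → ℝ)) × (Fin m → ℝ) → ℝ}, IsLinearMap ℝ l → IsPolyFn l :=
        fun h => IsPolyFn.lin h
      have p1 := (l1 (l := fun x => x.1.2 i) ⟨fun _ _ => rfl, fun _ _ => rfl⟩).sub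
        (l1 (l := fun x => x.2 i) ⟨fun _ _ => rfl, fun _ _ => rfl⟩)
      have p2 := l1 (l := fun x => x.1.1.2) ⟨fun _ _ => rfl, fun _ _ => rfl⟩
      exact SA.and (SA.le (p2.mul p1) (IsPolyFn.const 1)) (SA.le (p2.mul p1.neg) (IsPolyFn.const 1))
  · intro R
    obtain ⟨C, hC, rfl⟩ := hXc
    have hcomp : IsCompact (KR U R ∩ C) := (KR_compact U R).inter_right hC
    have hcont : ContinuousOn (fun x => (wt W (g x))⁻¹) (KR U R ∩ C) := by
      refine ContinuousOn.inv₀ (wt_cont.comp_continuousOn (hg.1.continuousOn.mono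
        (Set.inter_subset_left.trans (KR_sub U R)))) fun x hx => ?_
      exact (wt_pos hW (hgX x ⟨KR_sub U R hx.1, hx.2⟩)).ne'
    obtain ⟨M, hM⟩ := hcomp.exists_bound_of_continuousOn hcont
    refine ⟨M, ?_⟩
    rintro x hx s ⟨hxX, y, ⟨hxU, rfl⟩, hs⟩
    have hw := wt_pos hW (hgX x hxX)
    have h1 := (Real.le_norm_self _).trans (hM x ⟨hx, hxX.2⟩)
    refine le_trans ?_ h1
    rcases hs with ⟨i, hi⟩ | ⟨z, hz, hi⟩
    · have h2 := norm_le_pi_norm (g x) i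
      rw [Real.norm_eq_abs, abs_le'] at h2
      have h3 : s ≤ ‖g x‖ := by rcases hi with h | h <;> linarith
      have h4 := (le_inv_comm₀ hw (by positivity)).1 (wt_le_norm (U := W) (x := g x))
      linarith
    · by_cases hs : 0 < s
      · rw [le_inv_comm₀ hs hw]
        refine (wt_le_dist hz).trans ?_
        rw [pi_norm_le_iff_of_nonneg (by positivity)]
        intro i
        rw [Real.norm_eq_abs, abs_le', inv_eq_one_div, le_div_iff₀ hs, le_div_iff₀ hs]
        simp only [Pi.sub_apply]
        constructor <;> linarith [hi i]
      · push Not at hs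
        exact hs.trans (by positivity)

end wtcomp
end part8

section part9
open MeasureTheory
section kk
variable {n : ℕ} {U Y : Set (Fin n → ℝ)} {δ : (Fin n → ℝ) → ℝ}

/-- regularisation kernel integrals -/
noncomputable def KK {F : Type} [NormedAddCommGroup F] [NormedSpace ℝ F] (δ : (Fin n → ℝ) → ℝ)
    (Y : Set (Fin n → ℝ)) (m : ℕ) (η : (Fin n → ℝ) → F) (x : Fin n → ℝ) : F :=
  ∫ z in Y, ((δ z)⁻¹) ^ m • η ((δ z)⁻¹ • (x - z))

/-- hypotheses on scale functions -/
structure ScaleHyp (U Y : Set (Fin n → ℝ)) (δ : (Fin n → ℝ) → ℝ) : Prop where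
  opn : IsOpen U
  meas : MeasurableSet Y
  sub : Y ⊆ U
  pos : ∀ x ∈ U, 0 < δ x
  lip : ∀ x y, δ x ≤ δ y + ‖x - y‖ / 4

/-- hypotheses on kernels -/
structure KerHyp {F : Type} [NormedAddCommGroup F] [NormedSpace ℝ F] (η : (Fin n → ℝ) → F) : Prop where
  smooth : ContDiff ℝ (⊤ : ℕ∞) η
  supp : tsupport η ⊆ Metric.closedBall 0 1

variable {F : Type} [NormedAddCommGroup F] [NormedSpace ℝ F] {η : (Fin n → ℝ) → F}

theorem KerHyp.fderiv (h : KerHyp η) : KerHyp (fderiv ℝ η) :=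
  ⟨h.smooth.fderiv_right (by simp), (tsupport_fderiv_subset ℝ).trans h.supp⟩

theorem KerHyp.bdd (h : KerHyp η) : ∃ B, 0 < B ∧ ∀ x, ‖η x‖ ≤ B := by
  have hc : HasCompactSupport η := (isCompact_closedBall 0 1).of_isClosed_subset (isClosed_tsupport _) h.supp
  obtain ⟨B, hB⟩ := hc.exists_bound_of_continuous h.smooth.continuous
  exact ⟨max B 1, by positivity, fun x => (hB x).trans (le_max_left _ _)⟩

theorem ScaleHyp.cont (h : ScaleHyp U Y δ) : Continuous δ := by
  have : LipschitzWith 1 δ := LipschitzWith.of_le_add fun x y => by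
    rw [dist_eq_norm]; linarith [h.lip x y, norm_nonneg (x - y)]
  exact this.continuous

theorem kk_bound (h : ScaleHyp U Y δ) (hη : KerHyp η) {B : ℝ} (hB0 : 0 < B) (hB : ∀ x, ‖η x‖ ≤ B)
    {x0 x z : Fin n → ℝ} (hx0 : x0 ∈ U) (hx : ‖x - x0‖ ≤ δ x0 / 4) (hz : z ∈ Y) (m : ℕ) :
    ‖((δ z)⁻¹) ^ m • η ((δ z)⁻¹ • (x - z))‖ ≤
      (Metric.closedBall x0 (3 * δ x0)).indicator (fun _ => (2 / δ x0) ^ m * B) z := by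
  have hp := h.pos x0 hx0
  have hpz := h.pos z (h.sub hz)
  by_cases h0 : η ((δ z)⁻¹ • (x - z)) = 0
  · rw [h0, smul_zero, norm_zero]
    exact Set.indicator_nonneg (fun _ _ => by positivity) _
  have h1 : (δ z)⁻¹ • (x - z) ∈ Metric.closedBall (0 : Fin n → ℝ) 1 := hη.supp (subset_tsupport _ h0)
  rw [mem_closedBall_zero_iff, norm_smul, norm_inv, Real.norm_of_nonneg hpz.le,
    inv_mul_le_one₀ hpz] at h1
  have h2 : ‖z - x0‖ ≤ δ z + δ x0 / 4 := by
    have : z - x0 = (x - x0) - (x - z) := by abel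
    rw [this]
    exact (norm_sub_le _ _).trans (by linarith)
  have h3 := h.lip x0 z
  have h4 := h.lip z x0
  rw [norm_sub_rev] at h3
  have hmem : z ∈ Metric.closedBall x0 (3 * δ x0) := by
    rw [Metric.mem_closedBall, dist_eq_norm]; linarith
  rw [Set.indicator_of_mem hmem, norm_smul, norm_pow, norm_inv, Real.norm_of_nonneg hpz.le]
  refine mul_le_mul ?_ (hB _) (norm_nonneg _) (by positivity)
  refine pow_le_pow_left₀ (by positivity) ?_ _
  rw [inv_eq_one_div, div_le_div_iff₀ hpz hp]
  linarith

theorem kk_meas (h : ScaleHyp U Y δ) (hη : KerHyp η) (m : ℕ) (x : Fin n → ℝ) :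
    AEStronglyMeasurable (fun z => ((δ z)⁻¹) ^ m • η ((δ z)⁻¹ • (x - z))) (volume.restrict Y) := by
  refine ContinuousOn.aestronglyMeasurable ?_ h.meas
  have h1 : ContinuousOn (fun z => (δ z)⁻¹) Y :=
    h.cont.continuousOn.inv₀ fun z hz => (h.pos z (h.sub hz)).ne'
  refine (h1.pow m).smul (hη.smooth.continuous.comp_continuousOn (h1.smul ?_))
  fun_prop

theorem kk_ind_int (x0 : Fin n → ℝ) (r c : ℝ) :
    Integrable ((Metric.closedBall x0 r).indicator (fun _ => c)) (volume.restrict Y) := by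
  have : Integrable ((Metric.closedBall x0 r).indicator (fun _ => c)) (volume : Measure (Fin n → ℝ)) := by
    rw [integrable_indicator_iff measurableSet_closedBall]
    exact integrableOn_const measure_closedBall_lt_top.ne
  exact this.restrict

theorem kk_int (h : ScaleHyp U Y δ) (hη : KerHyp η) (m : ℕ) {x : Fin n → ℝ} (hx : x ∈ U) :
    Integrable (fun z => ((δ z)⁻¹) ^ m • η ((δ z)⁻¹ • (x - z))) (volume.restrict Y) := by
  obtain ⟨B, hB0, hB⟩ := hη.bdd
  refine (kk_ind_int x (3 * δ x) ((2 / δ x) ^ m * B)).mono' (kk_meas h hη m x) ?_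
  refine (ae_restrict_iff' h.meas).2 (Filter.Eventually.of_forall fun z hz => ?_)
  exact kk_bound h hη hB0 hB hx (by rw [sub_self, norm_zero]; linarith [h.pos x hx]) hz m

theorem kk_norm (h : ScaleHyp U Y δ) (hη : KerHyp η) (m : ℕ) {B : ℝ} (hB0 : 0 < B) (hB : ∀ x, ‖η x‖ ≤ B)
    {x : Fin n → ℝ} (hx : x ∈ U) : ‖KK δ Y m η x‖ ≤ (2 / δ x) ^ m * B * (6 * δ x) ^ n := by
  have hp := h.pos x hx
  unfold KK
  have h1 := norm_integral_le_of_norm_le (kk_ind_int (Y := Y) x (3 * δ x) ((2 / δ x) ^ m * B))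
    (f := fun z => ((δ z)⁻¹) ^ m • η ((δ z)⁻¹ • (x - z)))
    ((ae_restrict_iff' h.meas).2 (Filter.Eventually.of_forall fun z hz =>
      kk_bound h hη hB0 hB hx (by rw [sub_self, norm_zero]; linarith [h.pos x hx]) hz m))
  refine h1.trans ?_
  have h2 : ∫ z in Y, (Metric.closedBall x (3 * δ x)).indicator (fun _ => (2 / δ x) ^ m * B) z ≤
      ∫ z, (Metric.closedBall x (3 * δ x)).indicator (fun _ => (2 / δ x) ^ m * B) z := by
    refine setIntegral_le_integral ?_ ?_
    · simpa using kk_ind_int (Y := Set.univ) x (3 * δ x) ((2 / δ x) ^ m * B)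
    · exact Filter.Eventually.of_forall fun z => Set.indicator_nonneg (fun _ _ => by positivity) _
  refine h2.trans (le_of_eq ?_)
  rw [integral_indicator measurableSet_closedBall, setIntegral_const, Measure.real,
    Real.volume_pi_closedBall _ (by positivity), ENNReal.toReal_ofReal (by positivity), smul_eq_mul,
    Fintype.card_fin, mul_comm]
  ring

theorem kk_deriv (h : ScaleHyp U Y δ) (hη : KerHyp η) (m : ℕ) {x0 : Fin n → ℝ} (hx0 : x0 ∈ U) :
    HasFDerivAt (KK δ Y m η) (KK δ Y (m + 1) (fderiv ℝ η) x0) x0 := by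
  have hp := h.pos x0 hx0
  obtain ⟨B, hB0, hB⟩ := hη.fderiv.bdd
  refine hasFDerivAt_integral_of_dominated_of_fderiv_le (μ := volume.restrict Y)
    (F := fun x z => ((δ z)⁻¹) ^ m • η ((δ z)⁻¹ • (x - z)))
    (F' := fun x z => ((δ z)⁻¹) ^ (m + 1) • fderiv ℝ η ((δ z)⁻¹ • (x - z)))
    (bound := (Metric.closedBall x0 (3 * δ x0)).indicator (fun _ => (2 / δ x0) ^ (m + 1) * B))
    (Metric.closedBall_mem_nhds x0 (by positivity : 0 < δ x0 / 4)) ?_ ?_ ?_ ?_ ?_ ?_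
  · exact Filter.Eventually.of_forall fun x => kk_meas h hη m x
  · exact kk_int h hη m hx0
  · exact kk_meas h hη.fderiv (m + 1) x0
  · refine (ae_restrict_iff' h.meas).2 (Filter.Eventually.of_forall fun z hz x hx => ?_)
    exact kk_bound h hη.fderiv hB0 hB hx0 (by rwa [Metric.mem_closedBall, dist_eq_norm] at hx) hz _
  · exact kk_ind_int _ _ _
  · refine Filter.Eventually.of_forall fun z x hx => ?_
    have h1 : HasFDerivAt (fun x : Fin n → ℝ => (δ z)⁻¹ • (x - z))
        ((δ z)⁻¹ • ContinuousLinearMap.id ℝ (Fin n → ℝ)) x :=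
      ((hasFDerivAt_id x).sub_const z).fun_const_smul _
    have h2 : HasFDerivAt η (fderiv ℝ η ((δ z)⁻¹ • (x - z))) ((δ z)⁻¹ • (x - z)) :=
      (hη.smooth.differentiable (by simp) _).hasFDerivAt
    have h3 := (h2.comp x h1).const_smul ((δ z)⁻¹ ^ m)
    have e : (δ z)⁻¹ ^ (m + 1) • fderiv ℝ η ((δ z)⁻¹ • (x - z)) = (δ z)⁻¹ ^ m •
        (fderiv ℝ η ((δ z)⁻¹ • (x - z))).comp ((δ z)⁻¹ • ContinuousLinearMap.id ℝ (Fin n → ℝ)) := by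
      refine ContinuousLinearMap.ext fun v => ?_
      simp [pow_succ, mul_smul]
    simp only [e]
    exact h3

theorem kk_smoothN (h : ScaleHyp U Y δ) (N : ℕ) : ∀ {F : Type} [NormedAddCommGroup F] [NormedSpace ℝ F]
    {η : (Fin n → ℝ) → F} (_ : KerHyp η) (m : ℕ), ContDiffOn ℝ N (KK δ Y m η) U := by
  induction N with
  | zero =>
    intro F _ _ η hη m
    simp only [Nat.cast_zero, contDiffOn_zero]
    exact fun x hx => (kk_deriv h hη m hx).continuousAt.continuousWithinAt
  | succ N ih =>
    intro F _ _ η hη m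
    have := (contDiffOn_succ_iff_hasFDerivWithinAt_of_uniqueDiffOn (𝕜 := ℝ) (n := (N : WithTop ℕ∞))
      (f := KK δ Y m η) h.opn.uniqueDiffOn).2
      ⟨by simp, _, ih hη.fderiv (m + 1), fun x hx => (kk_deriv h hη m hx).hasFDerivWithinAt⟩
    exact_mod_cast this

theorem kk_smooth (h : ScaleHyp U Y δ) (hη : KerHyp η) (m : ℕ) :
    ContDiffOn ℝ (⊤ : ℕ∞) (KK δ Y m η) U :=
  contDiffOn_infty.2 fun N => kk_smoothN h N hη m

theorem kk_pb (h : ScaleHyp U Y δ) (h1 : ∀ x ∈ U, δ x ≤ 1) (hd : PB U (fun x => (δ x)⁻¹)) (k : ℕ) :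
    ∀ {F : Type} [NormedAddCommGroup F] [NormedSpace ℝ F]
    {η : (Fin n → ℝ) → F} (_ : KerHyp η) (m : ℕ), PB U (iteratedFDeriv ℝ k (KK δ Y m η)) := by
  have hdm : ∀ m, PB U (fun x => ((δ x)⁻¹) ^ m) := by
    intro m
    induction m with
    | zero => simpa using PB.const (1:ℝ)
    | succ m ih => simpa [pow_succ] using ih.mul hd
  induction k with
  | zero =>
    intro F _ _ η hη m
    obtain ⟨B, hB0, hB⟩ := hη.bdd
    refine PB.mono ((PB.const (2 ^ m * B * 6 ^ n)).mul (hdm m)) fun x hx => ?_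
    rw [norm_iteratedFDeriv_zero]
    refine (kk_norm h hη m hB0 hB hx).trans ?_
    have hp := h.pos x hx
    have : (6 * δ x) ^ n ≤ 6 ^ n := pow_le_pow_left₀ (by positivity) (by linarith [h1 x hx]) n
    calc (2 / δ x) ^ m * B * (6 * δ x) ^ n ≤ (2 / δ x) ^ m * B * 6 ^ n := by gcongr
      _ = _ := by rw [div_eq_mul_inv, mul_pow]; ring
  | succ k ih =>
    intro F _ _ η hη m
    refine PB.mono (ih hη.fderiv (m + 1)).norm fun x hx => ?_
    rw [← norm_iteratedFDeriv_fderiv]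
    have : fderiv ℝ (KK δ Y m η) =ᶠ[nhds x] KK δ Y (m + 1) (fderiv ℝ η) := by
      filter_upwards [h.opn.mem_nhds hx] with y hy
      exact (kk_deriv h hη m hy).fderiv
    rw [(Filter.EventuallyEq.iteratedFDeriv ℝ this k).eq_of_nhds]

end kk
end part9

section part10
open MeasureTheory
section cutoff
variable {n : ℕ} {U : Set (Fin n → ℝ)}

theorem comp_le {G H : Type*} [NormedAddCommGroup G] [NormedSpace ℝ G] [NormedAddCommGroup H]
    [NormedSpace ℝ H] (hU : IsOpen U) {f : (Fin n → ℝ) → G} (hf : ContDiffOn ℝ (⊤ : ℕ∞) f U)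
    {g : G → H} (hg : ContDiff ℝ (⊤ : ℕ∞) g) (k : ℕ) {x : Fin n → ℝ} (hx : x ∈ U) {C : ℝ}
    (hC : ∀ i ≤ k, ‖iteratedFDeriv ℝ i g (f x)‖ ≤ C) :
    ‖iteratedFDeriv ℝ k (fun y => g (f y)) x‖ ≤
      k.factorial * C * (1 + ∑ i ∈ Finset.range (k + 1), ‖iteratedFDeriv ℝ i f x‖) ^ k := by
  have h := norm_iteratedFDerivWithin_comp_le (𝕜 := ℝ) (n := k) (s := U) (t := Set.univ) (x := x)
    (N := ((⊤ : ℕ∞) : WithTop ℕ∞)) hg.contDiffOn hf (by exact_mod_cast le_top) uniqueDiffOn_univ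
    hU.uniqueDiffOn (Set.mapsTo_univ _ _) hx (C := C)
    (D := 1 + ∑ i ∈ Finset.range (k + 1), ‖iteratedFDeriv ℝ i f x‖) ?_ ?_
  · rwa [iteratedFDerivWithin_of_isOpen k hU hx] at h
  · intro i hi
    rw [iteratedFDerivWithin_univ]
    exact hC i hi
  · intro i h1 hi
    rw [iteratedFDerivWithin_of_isOpen i hU hx]
    have h2 : ‖iteratedFDeriv ℝ i f x‖ ≤ ∑ i ∈ Finset.range (k + 1), ‖iteratedFDeriv ℝ i f x‖ :=
      Finset.single_le_sum (f := fun i => ‖iteratedFDeriv ℝ i f x‖) (fun _ _ => norm_nonneg _)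
        (Finset.mem_range.2 (by omega))
    have h3 : 0 ≤ ∑ i ∈ Finset.range (k + 1), ‖iteratedFDeriv ℝ i f x‖ :=
      Finset.sum_nonneg fun _ _ => norm_nonneg _
    refine le_trans (by linarith) (le_self_pow₀ (by linarith) (by omega))

theorem PB.pow {f : (Fin n → ℝ) → ℝ} (hf : PB U f) (k : ℕ) : PB U (fun x => f x ^ k) := by
  induction k with
  | zero => simpa using PB.const (1:ℝ)
  | succ k ih => simpa only [pow_succ] using ih.mul hf

theorem pow_lip {a b t : ℝ} (ha0 : 0 ≤ a) (ha : a ≤ 1) (hb0 : 0 ≤ b) (hb : b ≤ 1) (ht : 0 ≤ t) (h : a ≤ b + t)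
    (k : ℕ) : a ^ k ≤ b ^ k + k * t := by
  induction k with
  | zero => simp
  | succ k ih =>
    have h1 : a ^ (k + 1) ≤ a * (b ^ k + k * t) := by
      rw [pow_succ']; exact mul_le_mul_of_nonneg_left ih ha0
    have h2 : b ^ k ≤ 1 := pow_le_one₀ hb0 hb
    have h3 : 0 ≤ b ^ k := pow_nonneg hb0 k
    have h4 : a * (k * t) ≤ k * t := mul_le_of_le_one_left (by positivity) ha
    have h5 : a * b ^ k ≤ (b + t) * b ^ k := mul_le_mul_of_nonneg_right h h3
    have h6 : t * b ^ k ≤ t := mul_le_of_le_one_right ht h2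
    push_cast
    have e : b ^ (k+1) = b * b ^ k := pow_succ' b k
    rw [e]
    nlinarith

theorem exists_cutoff (hU : IsOpen U) {X : Set (Fin n → ℝ)} (hX : X ⊆ U) (c' : ℝ) (hc' : 0 < c') (M : ℕ)
    (hM : 1 ≤ M) : ∃ χ : (Fin n → ℝ) → ℝ, ContDiffOn ℝ (⊤ : ℕ∞) χ U ∧ (∀ x ∈ X, χ x = 1) ∧
      (∀ x, χ x ≠ 0 → ∃ x' ∈ X, ‖x - x'‖ ≤ c' * wt U x' ^ M) ∧
      ∀ k, PB U (iteratedFDeriv ℝ k χ) := by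
  set c : ℝ := min (c' / 3) (1 / (4 * M)) with hc
  have hM0 : (1:ℝ) ≤ M := by exact_mod_cast hM
  have hc0 : 0 < c := lt_min (by positivity) (by positivity)
  have hcc' : c ≤ c' / 3 := min_le_left _ _
  have hcM : c * M ≤ 1 / 4 := by
    have := min_le_right (c' / 3) (1 / (4 * M))
    calc c * M ≤ (1 / (4 * M)) * M := by gcongr
      _ = 1 / 4 := by field_simp
  have hc1 : c ≤ 1 := by nlinarith
  set δ : (Fin n → ℝ) → ℝ := fun x => c * wt U x ^ M with hδ
  set Y : Set (Fin n → ℝ) := ⋃ x ∈ X, Metric.ball x (δ x) with hY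
  have hδw : ∀ x, δ x ≤ wt U x := fun x => by
    have h1 : wt U x ^ M ≤ wt U x := pow_le_of_le_one wt_nonneg wt_le_one (by omega)
    have := wt_nonneg (U := U) (x := x)
    calc c * wt U x ^ M ≤ 1 * wt U x ^ M := by gcongr
      _ ≤ _ := by linarith
  have hS : ScaleHyp U Y δ := by
    refine ⟨hU, ?_, ?_, ?_, ?_⟩
    · exact (isOpen_biUnion fun x _ => Metric.isOpen_ball).measurableSet
    · intro z hz
      simp only [hY, Set.mem_iUnion] at hz
      obtain ⟨x, hx, hz⟩ := hz
      by_contra hzU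
      have := wt_le_dist (x := x) hzU
      rw [Metric.mem_ball, dist_comm, dist_eq_norm] at hz
      linarith [hδw x]
    · intro x hx
      have := wt_pos hU hx
      positivity
    · intro x y
      have := pow_lip (wt_nonneg (U := U) (x := x)) wt_le_one (wt_nonneg (U := U) (x := y)) wt_le_one
        (norm_nonneg (x - y)) wt_lip M
      calc c * wt U x ^ M ≤ c * (wt U y ^ M + M * ‖x - y‖) := by gcongr
        _ = c * wt U y ^ M + (c * M) * ‖x - y‖ := by ring
        _ ≤ c * wt U y ^ M + (1 / 4) * ‖x - y‖ := by gcongr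
        _ = _ := by simp only [hδ]; ring
  have hδ1 : ∀ x ∈ U, δ x ≤ 1 := fun x _ => (hδw x).trans wt_le_one
  have hwpb : PB U (fun x => (wt U x)⁻¹) := ⟨1, 1, one_pos, fun x hx => by
    rw [Real.norm_of_nonneg (inv_nonneg.2 wt_nonneg)]; simp⟩
  have hδpb : PB U (fun x => (δ x)⁻¹) := by
    have := (PB.const (U := U) c⁻¹).mul (hwpb.pow M)
    simpa [hδ, mul_inv, mul_comm] using this
  let b : ContDiffBump (0 : Fin n → ℝ) := ⟨1/2, 1, by norm_num, by norm_num⟩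
  have hb : KerHyp (b : (Fin n → ℝ) → ℝ) := ⟨b.contDiff, by rw [b.tsupport_eq]⟩
  set k0 := KK δ Y n (b : (Fin n → ℝ) → ℝ) with hk0
  have hk0s : ContDiffOn ℝ (⊤ : ℕ∞) k0 U := kk_smooth hS hb n
  have hk0b : ∀ x ∈ U, ‖k0 x‖ ≤ 12 ^ n := by
    intro x hx
    have hp := hS.pos x hx
    refine (kk_norm hS hb n one_pos (fun x => ?_) hx).trans (le_of_eq ?_)
    · rw [Real.norm_of_nonneg b.nonneg]; exact b.le_one
    · rw [mul_one, ← mul_pow]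
      congr 1
      field_simp; norm_num
  have hk0n : ∀ x, 0 ≤ k0 x := fun x => integral_nonneg fun z => by
    have : 0 ≤ δ z := mul_nonneg hc0.le (pow_nonneg wt_nonneg _)
    exact smul_nonneg (by positivity) b.nonneg
  have hk0X : ∀ x ∈ X, 1 ≤ 4 ^ n * k0 x := by
    intro x hx
    have hp := hS.pos x (hX hx)
    have hsub : Metric.ball x (δ x / 4) ⊆ Y := fun z hz => by
      refine Set.mem_biUnion hx (Metric.ball_subset_ball (by linarith) hz)
    have h1 : ∫ z in Metric.ball x (δ x / 4), ((2 * δ x)⁻¹) ^ n ≤ k0 x := by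
      have hi := kk_int hS hb n (hX hx)
      refine le_trans ?_ (setIntegral_mono_set hi (Filter.Eventually.of_forall fun z => ?_)
        (HasSubset.Subset.eventuallyLE hsub))
      · refine setIntegral_mono_on ?_ (hi.mono_measure (Measure.restrict_mono hsub le_rfl))
          measurableSet_ball fun z hz => ?_
        · exact integrableOn_const measure_ball_lt_top.ne
        · rw [Metric.mem_ball, dist_eq_norm] at hz
          have hzp := hS.pos z (hS.sub (hsub (by rwa [Metric.mem_ball, dist_eq_norm])))
          have l1 := hS.lip x z
          have l2 := hS.lip z x
          rw [norm_sub_rev] at l1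
          have : b ((δ z)⁻¹ • (x - z)) = 1 := by
            refine b.one_of_mem_closedBall ?_
            rw [mem_closedBall_zero_iff, norm_smul, norm_inv, Real.norm_of_nonneg hzp.le,
              inv_mul_le_iff₀ hzp, norm_sub_rev]
            change _ ≤ δ z * (1 / 2)
            linarith
          simp only [this, smul_eq_mul, mul_one]
          refine pow_le_pow_left₀ (by positivity) ?_ _
          exact inv_anti₀ hzp (by linarith)
      · have : 0 ≤ δ z := mul_nonneg hc0.le (pow_nonneg wt_nonneg _)
        exact smul_nonneg (by positivity) b.nonneg
    rw [setIntegral_const, Measure.real, Real.volume_pi_ball _ (by positivity),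
      ENNReal.toReal_ofReal (by positivity), smul_eq_mul, Fintype.card_fin, ← mul_pow] at h1
    have e : 2 * (δ x / 4) * (2 * δ x)⁻¹ = 4⁻¹ := by field_simp
    rw [e, inv_pow] at h1
    rwa [← inv_le_iff_one_le_mul₀' (by positivity)]
  have hts : ContDiff ℝ (⊤ : ℕ∞) (fun s : ℝ => Real.smoothTransition (4 ^ n * s)) :=
    Real.smoothTransition.contDiff.comp (by fun_prop)
  refine ⟨fun x => Real.smoothTransition (4 ^ n * k0 x), ?_, ?_, ?_, ?_⟩
  · exact hts.comp_contDiffOn hk0s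
  · intro x hx
    exact Real.smoothTransition.one_of_one_le (hk0X x hx)
  · intro x hx
    have hk : k0 x ≠ 0 := fun h => hx (by simp [h])
    by_contra hcon
    push Not at hcon
    refine hk (setIntegral_eq_zero_of_forall_eq_zero fun z hz => ?_)
    by_contra hne
    have hη : b ((δ z)⁻¹ • (x - z)) ≠ 0 := fun h => hne (by rw [h, smul_zero])
    have hzp := hS.pos z (hS.sub hz)
    have h1 := hb.supp (subset_tsupport _ hη)
    rw [mem_closedBall_zero_iff, norm_smul, norm_inv, Real.norm_of_nonneg hzp.le,
      inv_mul_le_one₀ hzp] at h1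
    simp only [hY, Set.mem_iUnion] at hz
    obtain ⟨x', hx', hz⟩ := hz
    rw [Metric.mem_ball, dist_eq_norm] at hz
    have h2 := hcon x' hx'
    have l1 := hS.lip z x'
    have h3 : ‖x - x'‖ ≤ ‖x - z‖ + ‖z - x'‖ := norm_sub_le_norm_sub_add_norm_sub _ _ _
    have hp := hS.pos x' (hX hx')
    have h4 : 3 * δ x' ≤ c' * wt U x' ^ M := by
      have := pow_nonneg (wt_nonneg (U := U) (x := x')) M
      simp only [hδ]
      nlinarith
    linarith
  · intro k
    have hcpt : IsCompact (Metric.closedBall (0:ℝ) (12 ^ n)) := isCompact_closedBall _ _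
    have hex : ∀ i : ℕ, ∃ C, ∀ s ∈ Metric.closedBall (0:ℝ) (12 ^ n),
        ‖iteratedFDeriv ℝ i (fun s : ℝ => Real.smoothTransition (4 ^ n * s)) s‖ ≤ C := fun i =>
      hcpt.exists_bound_of_continuousOn (hts.continuous_iteratedFDeriv (by exact_mod_cast le_top)).continuousOn
    choose C hC using hex
    have hpb := kk_pb hS hδ1 hδpb
    have h1 : PB U (fun x => (1 + ∑ i ∈ Finset.range (k + 1), ‖iteratedFDeriv ℝ i k0 x‖)) :=
      PB.add hU (PB.const 1) (PB.sum hU _ fun i _ => (hpb i hb n).norm)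
    refine PB.mono ((PB.const (k.factorial * ∑ i ∈ Finset.range (k + 1), |C i|)).mul (h1.pow k)) fun x hx => ?_
    refine comp_le hU hk0s hts k hx fun i hi => ?_
    refine (hC i _ (by simpa using hk0b x hx)).trans ((le_abs_self _).trans ?_)
    exact Finset.single_le_sum (f := fun i => |C i|) (fun _ _ => abs_nonneg _) (Finset.mem_range.2 (by omega))

end cutoff
end part10

section part11
open scoped Topology
section final
variable {n m : ℕ} {U : Set (Fin n → ℝ)}

theorem flat_dist (f : SchwartzMap (Fin n → ℝ) ℝ) (hf : ∀ z ∈ Uᶜ, SmoothFlatAt (⇑f) z) (N k : ℕ) :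
    ∃ C, 0 < C ∧ ∀ y, ∀ z ∉ U, ‖iteratedFDeriv ℝ k f y‖ ≤ C * ‖y - z‖ ^ N := by
  induction N generalizing k with
  | zero =>
    obtain ⟨C, hC⟩ := f.decay' 0 k
    refine ⟨|C| + 1, by positivity, fun y z _ => ?_⟩
    have := hC y
    simp only [pow_zero, one_mul, mul_one] at this ⊢
    have h2 := le_abs_self C
    exact le_trans this (by linarith)
  | succ N ih =>
    obtain ⟨C, hC0, hC⟩ := ih (k + 1)
    refine ⟨C, hC0, fun y z hz => ?_⟩
    have h := Convex.norm_image_sub_le_of_norm_fderiv_le (𝕜 := ℝ) (f := iteratedFDeriv ℝ k f)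
      (s := segment ℝ z y) (x := z) (y := y) (C := C * ‖y - z‖ ^ N) ?_ ?_ (convex_segment _ _)
      (left_mem_segment _ _ _) (right_mem_segment _ _ _)
    · rw [hf z hz k, sub_zero] at h
      rw [pow_succ, ← mul_assoc]; exact h
    · intro x _
      exact (f.smooth ⊤).contDiffAt.differentiableAt_iteratedFDeriv (by exact_mod_cast ENat.natCast_lt_top k)
    · intro x hx
      rw [norm_fderiv_iteratedFDeriv]
      refine (hC x z hz).trans ?_
      have : ‖x - z‖ ≤ ‖y - z‖ := by
        have := norm_sub_le_of_mem_segment hx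
        simpa using this
      gcongr

theorem flat_wt (hU : IsOpen U) (f : SchwartzMap (Fin n → ℝ) ℝ) (hf : ∀ z ∈ Uᶜ, SmoothFlatAt (⇑f) z) (N k : ℕ) :
    ∃ C, 0 < C ∧ ∀ y, ‖iteratedFDeriv ℝ k f y‖ ≤ C * wt U y ^ N := by
  obtain ⟨C, hC0, hC⟩ := flat_dist f hf N k
  obtain ⟨C', hC'⟩ : ∃ C', ∀ y, (1 + ‖y‖) ^ N * ‖iteratedFDeriv ℝ k f y‖ ≤ C' :=
    ⟨_, fun y => SchwartzMap.one_add_le_sup_seminorm_apply (𝕜 := ℝ) (m := (N, k)) le_rfl le_rfl f y⟩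
  refine ⟨C + |C'|, by positivity, fun y => ?_⟩
  have hA : ‖iteratedFDeriv ℝ k f y‖ ≤ (C + |C'|) * ((1 + ‖y‖)⁻¹) ^ N := by
    have h1 := (hC' y).trans (le_abs_self C')
    rw [inv_pow, ← div_eq_mul_inv, le_div_iff₀ (by positivity)]
    linarith
  unfold wt
  by_cases hu : U = Set.univ
  · rw [if_pos hu, min_eq_left (inv_le_one_of_one_le₀ (by linarith [norm_nonneg y]))]
    exact hA
  · rw [if_neg hu]
    rcases min_choice ((1 + ‖y‖)⁻¹) (Metric.infDist y Uᶜ) with h | h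
    · rw [h]; exact hA
    · rw [h]
      obtain ⟨z, hz, e⟩ := hU.isClosed_compl.exists_infDist_eq_dist (Set.nonempty_compl.2 hu) y
      rw [e, dist_eq_norm]
      refine (hC y z hz).trans ?_
      gcongr
      linarith [abs_nonneg C']

theorem flat_wt_le (hU : IsOpen U) (f : SchwartzMap (Fin n → ℝ) ℝ) (hf : ∀ z ∈ Uᶜ, SmoothFlatAt (⇑f) z) (N k : ℕ) :
    ∃ C, 0 < C ∧ ∀ i ≤ k, ∀ y, ‖iteratedFDeriv ℝ i f y‖ ≤ C * wt U y ^ N := by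
  choose C hC0 hC using flat_wt hU f hf N
  refine ⟨∑ i ∈ Finset.range (k + 1), C i, Finset.sum_pos (fun i _ => hC0 i) (by simp), fun i hi y => ?_⟩
  refine (hC i y).trans ?_
  refine mul_le_mul_of_nonneg_right ?_ (pow_nonneg wt_nonneg _)
  exact Finset.single_le_sum (fun i _ => (hC0 i).le) (Finset.mem_range.2 (by omega))

open Classical in
theorem ext_taylor (hU : IsOpen U) {F : (Fin n → ℝ) → ℝ} (hF0 : ∀ x ∉ U, F x = 0)
    (hF : ContDiffOn ℝ (⊤ : ℕ∞) F U)
    (hb : ∀ k N : ℕ, ∃ C, ∀ x ∈ U, ‖iteratedFDeriv ℝ k F x‖ ≤ C * wt U x ^ N) :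
    HasFTaylorSeriesUpTo (𝕜 := ℝ) ((⊤ : ℕ∞) : WithTop ℕ∞) F
      (fun x k => if x ∈ U then iteratedFDeriv ℝ k F x else 0) := by
  have hd : ∀ (k : ℕ) x, HasFDerivAt (fun y => if y ∈ U then iteratedFDeriv ℝ k F y else 0)
      (if x ∈ U then iteratedFDeriv ℝ (k + 1) F x else 0).curryLeft x := by
    intro k x
    by_cases hx : x ∈ U
    · rw [if_pos hx]
      have h1 : HasFDerivAt (iteratedFDeriv ℝ k F) (iteratedFDeriv ℝ (k + 1) F x).curryLeft x := by
        have h2 := ((hF.contDiffAt (hU.mem_nhds hx)).differentiableAt_iteratedFDeriv (m := k)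
          (by exact_mod_cast ENat.natCast_lt_top k)).hasFDerivAt
        rw [fderiv_iteratedFDeriv] at h2
        exact h2
      refine h1.congr_of_eventuallyEq ?_
      filter_upwards [hU.mem_nhds hx] with y hy
      rw [if_pos hy]
    · rw [if_neg hx]
      obtain ⟨C, hC⟩ := hb k 2
      have h1 : (fun y => if y ∈ U then iteratedFDeriv ℝ k F y else 0) =O[𝓝 x] fun y => ‖y - x‖ ^ 2 := by
        refine Asymptotics.IsBigO.of_bound |C| (Filter.Eventually.of_forall fun y => ?_)
        rw [Real.norm_of_nonneg (by positivity : 0 ≤ ‖y - x‖ ^ 2)]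
        by_cases hy : y ∈ U
        · rw [if_pos hy]
          have h3 : 0 ≤ wt U y := wt_nonneg
          calc _ ≤ C * wt U y ^ 2 := hC y hy
            _ ≤ |C| * wt U y ^ 2 := by gcongr; exact le_abs_self C
            _ ≤ _ := by gcongr; exact wt_le_dist hx
        · rw [if_neg hy, norm_zero]; positivity
      have h2 := h1.hasFDerivAt (𝕜 := ℝ) one_lt_two
      have e0 : (0 : ContinuousMultilinearMap ℝ (fun _ : Fin (k + 1) => (Fin n → ℝ)) ℝ).curryLeft = 0 := by
        ext; rfl
      rw [e0]
      exact h2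
  refine ⟨fun x => ?_, fun k _ x => hd k x, fun k _ => ?_⟩
  · by_cases hx : x ∈ U
    · simp [hx]
    · simp [hx, hF0 x hx]
  · exact continuous_iff_continuousAt.2 fun x => (hd k x).continuousAt

theorem ext_schwartz (hU : IsOpen U) {F : (Fin n → ℝ) → ℝ} (hF0 : ∀ x ∉ U, F x = 0)
    (hF : ContDiffOn ℝ (⊤ : ℕ∞) F U)
    (hb : ∀ k N : ℕ, ∃ C, ∀ x ∈ U, ‖iteratedFDeriv ℝ k F x‖ ≤ C * wt U x ^ N) :
    ∃ f : SchwartzMap (Fin n → ℝ) ℝ, (∀ z ∈ Uᶜ, SmoothFlatAt (⇑f) z) ∧ ∀ x, f x = F x := by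
  have h := ext_taylor hU hF0 hF hb
  have hz : ∀ z ∉ U, ∀ k, iteratedFDeriv ℝ k F z = 0 := by
    intro z hz k
    rw [← h.eq_iteratedFDeriv (m := k) (by exact_mod_cast le_top) z, if_neg hz]
  refine ⟨⟨F, h.contDiff, fun k j => ?_⟩, fun z hz' k => hz z hz' k, fun x => rfl⟩
  obtain ⟨C, hC⟩ := hb j k
  refine ⟨|C|, fun x => ?_⟩
  by_cases hx : x ∈ U
  · have h3 : 0 ≤ wt U x := wt_nonneg
    have h4 : ‖x‖ * wt U x ≤ 1 := by
      have h5 := wt_le_norm (U := U) (x := x)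
      rw [inv_eq_one_div, le_div_iff₀ (by positivity)] at h5
      nlinarith
    calc ‖x‖ ^ k * ‖iteratedFDeriv ℝ j F x‖ ≤ ‖x‖ ^ k * (C * wt U x ^ k) := by
          gcongr; exact hC x hx
      _ = C * (‖x‖ * wt U x) ^ k := by rw [mul_pow]; ring
      _ ≤ |C| * (‖x‖ * wt U x) ^ k := by gcongr; exact le_abs_self C
      _ ≤ |C| * 1 := by gcongr; exact pow_le_one₀ (by positivity) h4
      _ = |C| := mul_one _
  · rw [hz x hx j, norm_zero, mul_zero]; positivity

theorem cutoff_comp (hU : IsOpen U) (hUs : SA U) {W : Set (Fin m → ℝ)} {X : Set (Fin n → ℝ)} (hXU : X ⊆ U)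
    {g : (Fin n → ℝ) → (Fin m → ℝ)} (hg : IsNashMap U g) {K : ℝ} (hK : 0 < K) {N : ℕ}
    (hX : ∀ x ∈ X, wt W (g x) ^ N ≤ K * wt U x) :
    ∃ (χ : (Fin n → ℝ) → ℝ) (K' : ℝ), 0 < K' ∧ ContDiffOn ℝ (⊤ : ℕ∞) χ U ∧ (∀ x ∈ X, χ x = 1) ∧
      (∀ x ∈ U, x ∈ tsupport χ → wt W (g x) ^ N ≤ K' * wt U x) ∧
      ∀ k, PB U (iteratedFDeriv ℝ k χ) := by
  obtain ⟨K1, N1, hK1, H1⟩ := hg.pbk hU hUs 1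
  set c' : ℝ := min (1 / 2) (1 / (K1 * 2 ^ N1)) with hc'
  have hc0 : 0 < c' := lt_min (by norm_num) (by positivity)
  have hc1 : c' ≤ 1 / 2 := min_le_left _ _
  have hc2 : K1 * 2 ^ N1 * c' ≤ 1 := by
    have : c' ≤ 1 / (K1 * 2 ^ N1) := min_le_right _ _
    rw [le_div_iff₀ (by positivity)] at this
    linarith
  obtain ⟨χ, hχs, hχ1, hχ0, hχb⟩ := exists_cutoff hU hXU c' hc0 (N1 + 1) (by omega)
  have key : ∀ x ∈ U, χ x ≠ 0 → wt W (g x) ^ N ≤ 2 * (K + N) * wt U x := by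
    intro x hx hne
    obtain ⟨x', hx', hd⟩ := hχ0 x hne
    have ht0 := wt_pos hU (hXU hx')
    have ht1 : wt U x' ≤ 1 := wt_le_one
    set t := wt U x' with htdef
    have hd2 : ‖x - x'‖ ≤ t / 2 := by
      have h1 : t ^ (N1 + 1) ≤ t := by
        have : t ^ N1 ≤ 1 := pow_le_one₀ ht0.le ht1
        rw [pow_succ]; nlinarith
      calc _ ≤ c' * t ^ (N1 + 1) := hd
        _ ≤ 1 / 2 * t := mul_le_mul hc1 h1 (by positivity) (by norm_num)
        _ = t / 2 := by ring
    have hball : ∀ y ∈ Metric.closedBall x' (t / 2), t / 2 ≤ wt U y ∧ y ∈ U := by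
      intro y hy
      rw [mem_closedBall_iff_norm] at hy
      have h1 : t ≤ wt U y + ‖x' - y‖ := wt_lip
      rw [norm_sub_rev] at h1
      refine ⟨by linarith, ?_⟩
      by_contra hyU
      rw [wt_zero hyU] at h1
      linarith
    have hgd : ‖g x - g x'‖ ≤ t := by
      have h := Convex.norm_image_sub_le_of_norm_fderiv_le (𝕜 := ℝ) (f := g)
        (s := Metric.closedBall x' (t / 2)) (x := x') (y := x) (C := K1 * (t / 2)⁻¹ ^ N1) ?_ ?_
        (convex_closedBall _ _) (Metric.mem_closedBall_self (by positivity))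
        (by rwa [mem_closedBall_iff_norm])
      · refine h.trans ?_
        calc _ ≤ K1 * (t / 2)⁻¹ ^ N1 * (c' * t ^ (N1 + 1)) := by gcongr
          _ = (K1 * 2 ^ N1 * c') * t := by rw [inv_div, div_pow]; field_simp; ring
          _ ≤ 1 * t := by gcongr
          _ = t := one_mul t
      · intro y hy
        exact (hg.1.contDiffAt (hU.mem_nhds (hball y hy).2)).differentiableAt (by simp)
      · intro y hy
        rw [← norm_iteratedFDeriv_one]
        refine (H1 y (hball y hy).2).trans ?_
        have h5 := inv_anti₀ (by positivity) (hball y hy).1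
        have h6 : 0 ≤ (wt U y)⁻¹ := inv_nonneg.2 wt_nonneg
        gcongr
    have hl : wt W (g x) ≤ wt W (g x') + t := wt_lip.trans (by linarith)
    have hp := pow_lip wt_nonneg wt_le_one wt_nonneg wt_le_one ht0.le hl N
    have hX' := hX x' hx'
    have h2 : t ≤ wt U x + ‖x' - x‖ := wt_lip
    rw [norm_sub_rev] at h2
    have h3 : t ≤ 2 * wt U x := by linarith
    calc _ ≤ (K + N) * t := by linarith
      _ ≤ (K + N) * (2 * wt U x) := by gcongr
      _ = _ := by ring
  refine ⟨χ, 2 * (K + N), by positivity, hχs, hχ1, ?_, hχb⟩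
  intro x hx hxs
  by_contra! hlt
  have hgc : ContinuousAt g x := hg.1.continuousOn.continuousAt (hU.mem_nhds hx)
  have c1 : ContinuousAt (fun y => wt W (g y) ^ N) x :=
    ContinuousAt.pow (ContinuousAt.comp (g := wt W) wt_cont.continuousAt hgc) N
  have c2 : ContinuousAt (fun y => 2 * (K + N) * wt U y) x :=
    continuousAt_const.mul wt_cont.continuousAt
  have hev := c2.eventually_lt c1 hlt
  have hfr := mem_closure_iff_frequently.1 hxs
  obtain ⟨y, hy1, hy2, hy3⟩ := (hfr.and_eventually (hev.and (hU.mem_nhds hx))).exists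
  exact absurd (key y hy3 hy1) (not_le.2 hy2)

theorem half_est (hU : IsOpen U) (hUs : SA U) {W : Set (Fin m → ℝ)} (hW : IsOpen W)
    {g : (Fin n → ℝ) → (Fin m → ℝ)} (hg : IsNashMap U g) {K : ℝ} (hK : 0 < K) {N : ℕ}
    {χ : (Fin n → ℝ) → ℝ} (hχs : ContDiffOn ℝ (⊤ : ℕ∞) χ U)
    (hχt : ∀ x ∈ U, x ∈ tsupport χ → wt W (g x) ^ N ≤ K * wt U x)
    (hχb : ∀ k, PB U (iteratedFDeriv ℝ k χ))
    (f : SchwartzMap (Fin m → ℝ) ℝ) (hf : ∀ z ∈ Wᶜ, SmoothFlatAt (⇑f) z) (k L : ℕ) :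
    ∃ C, ∀ x ∈ U, ‖iteratedFDeriv ℝ k (fun y => χ y * f (g y)) x‖ ≤ C * wt U x ^ L := by
  have hA : PB U (fun x => ∑ i ∈ Finset.range (k + 1), (k.choose i : ℝ) * ‖iteratedFDeriv ℝ i χ x‖ *
      ((k - i).factorial * (1 + ∑ j ∈ Finset.range (k - i + 1), ‖iteratedFDeriv ℝ j g x‖) ^ (k - i))) :=
    PB.sum hU _ fun i _ => ((PB.const _).mul (hχb i).norm).mul ((PB.const _).mul
      (PB.pow (PB.add hU (PB.const _) (PB.sum hU _ fun j _ => (hg.pbk hU hUs j).norm)) _))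
  obtain ⟨K3, Q, hK3, H3⟩ := hA
  obtain ⟨C, hC0, hC⟩ := flat_wt_le hW f hf (N * (Q + L)) k
  refine ⟨K3 * C * K ^ (Q + L), fun x hx => ?_⟩
  have hw := wt_pos hU hx
  have hfg : ContDiffOn ℝ (⊤ : ℕ∞) (fun y => f (g y)) U := (f.smooth ⊤).comp_contDiffOn hg.1
  have hL := norm_iteratedFDerivWithin_mul_le (𝕜 := ℝ) (n := k) hχs hfg hU.uniqueDiffOn hx
    (by exact_mod_cast le_top)
  rw [iteratedFDerivWithin_of_isOpen k hU hx] at hL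
  by_cases hxs : x ∈ tsupport χ
  · have hD : ∀ j ≤ k, ‖iteratedFDeriv ℝ j (fun y => f (g y)) x‖ ≤ (j.factorial *
        (1 + ∑ i ∈ Finset.range (j + 1), ‖iteratedFDeriv ℝ i g x‖) ^ j) * (C * (K * wt U x) ^ (Q + L)) := by
      intro j hj
      refine (comp_le hU hg.1 (f.smooth ⊤) j hx (C := C * (K * wt U x) ^ (Q + L)) ?_).trans
        (le_of_eq (by ring))
      intro i hi
      refine (hC i (hi.trans hj) (g x)).trans ?_
      rw [pow_mul]
      have := hχt x hx hxs
      have h0 : 0 ≤ wt W (g x) := wt_nonneg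
      gcongr
    calc _ ≤ _ := hL
      _ ≤ ∑ i ∈ Finset.range (k + 1), ((k.choose i : ℝ) * ‖iteratedFDeriv ℝ i χ x‖ *
      ((k - i).factorial * (1 + ∑ j ∈ Finset.range (k - i + 1), ‖iteratedFDeriv ℝ j g x‖) ^ (k - i))) *
          (C * (K * wt U x) ^ (Q + L)) := by
        refine Finset.sum_le_sum fun i _ => ?_
        rw [iteratedFDerivWithin_of_isOpen i hU hx, iteratedFDerivWithin_of_isOpen (k - i) hU hx,
          mul_assoc _ _ (C * (K * wt U x) ^ (Q + L))]
        exact mul_le_mul_of_nonneg_left (hD _ (Nat.sub_le _ _)) (by positivity)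
      _ ≤ (K3 * (wt U x)⁻¹ ^ Q) * (C * (K * wt U x) ^ (Q + L)) := by
        rw [← Finset.sum_mul]
        exact mul_le_mul_of_nonneg_right ((Real.le_norm_self _).trans (H3 x hx)) (by positivity)
      _ = _ := by
        rw [mul_pow, pow_add (wt U x), inv_pow]
        field_simp
  · refine hL.trans ?_
    rw [Finset.sum_eq_zero]
    · positivity
    · intro i _
      have h0 : iteratedFDeriv ℝ i χ x = 0 := by
        by_contra h
        exact hxs (support_iteratedFDeriv_subset i h)
      rw [iteratedFDerivWithin_of_isOpen i hU hx, h0]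
      simp

theorem half_main (hU : IsOpen U) (hUs : SA U) {W : Set (Fin m → ℝ)} (hW : IsOpen W) (hWs : SA W)
    {X : Set (Fin n → ℝ)} (hXU : X ⊆ U) {Y : Set (Fin m → ℝ)} (hYs : SA Y) (hYW : Y ⊆ W)
    (hYc : ∃ C, IsClosed C ∧ Y = W ∩ C)
    {g : (Fin n → ℝ) → (Fin m → ℝ)} (hg : IsNashMap U g) {g' : (Fin m → ℝ) → (Fin n → ℝ)}
    (hg' : IsNashMap W g') (hgX : ∀ x ∈ X, g x ∈ Y) (hg'Y : ∀ y ∈ Y, g' y ∈ X)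
    (hgg : ∀ x ∈ X, g' (g x) = x)
    (f : SchwartzMap (Fin m → ℝ) ℝ) (hf : ∀ z ∈ Wᶜ, SmoothFlatAt (⇑f) z) :
    ∃ F : SchwartzMap (Fin n → ℝ) ℝ, (∀ z ∈ Uᶜ, SmoothFlatAt (⇑F) z) ∧ ∀ x ∈ X, F x = f (g x) := by
  classical
  obtain ⟨K, N, hK, H⟩ := wt_comp hW hWs hU hUs hYs hYW hYc hg' (fun y hy => hXU (hg'Y y hy))
  have hX : ∀ x ∈ X, wt W (g x) ^ N ≤ K * wt U x := by
    intro x hx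
    have h := H (g x) (hgX x hx)
    rw [hgg x hx] at h
    have h1 := wt_pos hU (hXU hx)
    have h2 := wt_pos hW (hYW (hgX x hx))
    rw [inv_pow, ← div_eq_mul_inv, le_div_iff₀ (by positivity), inv_mul_le_iff₀ h1] at h
    linarith
  obtain ⟨χ, K', hK', hχs, hχ1, hχt, hχb⟩ := cutoff_comp hU hUs hXU hg hK hX
  have hev : ∀ x ∈ U, (fun y => if y ∈ U then χ y * f (g y) else 0) =ᶠ[𝓝 x] fun y => χ y * f (g y) := by
    intro x hx
    filter_upwards [hU.mem_nhds hx] with y hy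
    rw [if_pos hy]
  have hmain := ext_schwartz hU (F := fun y => if y ∈ U then χ y * f (g y) else 0)
    (fun x hx => if_neg hx) ?_ ?_
  · obtain ⟨F, hF1, hF2⟩ := hmain
    refine ⟨F, hF1, fun x hx => ?_⟩
    rw [hF2, if_pos (hXU hx), hχ1 x hx, one_mul]
  · exact (hχs.mul ((f.smooth ⊤).comp_contDiffOn hg.1)).congr fun x hx => if_pos hx
  · intro k L
    obtain ⟨C, hC⟩ := half_est hU hUs hW hg hK' hχs hχt hχb f hf k L
    refine ⟨C, fun x hx => ?_⟩
    rw [((hev x hx).iteratedFDeriv ℝ k).eq_of_nhds]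
    exact hC x hx

theorem relclosed {X : Set (Fin n → ℝ)} (hXU : X ⊆ U) (h : IsClosed ((Subtype.val ⁻¹' X : Set ↥U))) :
    ∃ C, IsClosed C ∧ X = U ∩ C := by
  obtain ⟨C, hC, e⟩ := isClosed_induced_iff.1 h
  refine ⟨C, hC, ?_⟩
  ext x
  constructor
  · intro hx
    refine ⟨hXU hx, ?_⟩
    have : (⟨x, hXU hx⟩ : U) ∈ (Subtype.val ⁻¹' C : Set ↥U) := by rw [e]; exact hx
    exact this
  · rintro ⟨hx, hxC⟩
    have : (⟨x, hx⟩ : U) ∈ (Subtype.val ⁻¹' X : Set ↥U) := by rw [← e]; exact hxC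
    exact this
end final
end part11

/-- If `φ : X₁ → X₂` is a bijection between semialgebraic sets (each `Xᵢ` closed in an
open semialgebraic `Uᵢ`) such that both `φ` and `φ⁻¹` are restrictions of Nash maps,
then pullback by `φ` maps `𝓢_{U₂}(X₂)` bijectively onto `𝓢_{U₁}(X₁)`. -/
theorem stmt_6 {n₁ n₂ : ℕ}
    (X₁ U₁ : Set (Fin n₁ → ℝ)) (X₂ U₂ : Set (Fin n₂ → ℝ))
    (hX₁sa : IsSemialgebraic X₁) (hX₂sa : IsSemialgebraic X₂)
    (hU₁o : IsOpen U₁) (hU₁sa : IsSemialgebraic U₁)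
    (hU₂o : IsOpen U₂) (hU₂sa : IsSemialgebraic U₂)
    (hX₁U₁ : X₁ ⊆ U₁) (hX₂U₂ : X₂ ⊆ U₂)
    (hX₁cl : IsClosed ((Subtype.val ⁻¹' X₁ : Set ↥U₁)))
    (hX₂cl : IsClosed ((Subtype.val ⁻¹' X₂ : Set ↥U₂)))
    (φ : ↥X₁ → ↥X₂) (hφbij : Function.Bijective φ)
    (g₁ : (Fin n₁ → ℝ) → (Fin n₂ → ℝ)) (hg₁ : IsNashMap U₁ g₁)
    (hg₁φ : ∀ x : ↥X₁, ((φ x : ↥X₂) : Fin n₂ → ℝ) = g₁ (x : Fin n₁ → ℝ))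
    (g₂ : (Fin n₂ → ℝ) → (Fin n₁ → ℝ)) (hg₂ : IsNashMap U₂ g₂)
    (hg₂φ : ∀ x : ↥X₁, g₂ ((φ x : ↥X₂) : Fin n₂ → ℝ) = (x : Fin n₁ → ℝ)) :
    (fun f : ↥X₂ → ℝ => f ∘ φ) '' SchwartzRelOpen U₂ X₂ = SchwartzRelOpen U₁ X₁ := by
  have c1 := relclosed hX₁U₁ hX₁cl
  have c2 := relclosed hX₂U₂ hX₂cl
  have m1 : ∀ x ∈ X₁, g₁ x ∈ X₂ := fun x hx => by
    rw [← hg₁φ ⟨x, hx⟩]; exact (φ ⟨x, hx⟩).2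
  have r1 : ∀ x ∈ X₁, g₂ (g₁ x) = x := fun x hx => by
    have := hg₂φ ⟨x, hx⟩
    rwa [hg₁φ] at this
  have m2 : ∀ y ∈ X₂, g₂ y ∈ X₁ := fun y hy => by
    obtain ⟨x, hx⟩ := hφbij.2 ⟨y, hy⟩
    have := hg₂φ x
    rw [hx] at this
    change g₂ y = x at this
    rw [this]; exact x.2
  have r2 : ∀ y ∈ X₂, g₁ (g₂ y) = y := fun y hy => by
    obtain ⟨x, hx⟩ := hφbij.2 ⟨y, hy⟩
    have h1 := hg₂φ x
    have h2 := hg₁φ x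
    rw [hx] at h1 h2
    change g₂ y = x at h1
    change y = g₁ x at h2
    rw [h1, ← h2]
  ext h
  constructor
  · rintro ⟨f, ⟨p, hp, hpf⟩, rfl⟩
    obtain ⟨F, hF, hFe⟩ := half_main hU₁o hU₁sa.sa hU₂o hU₂sa.sa hX₁U₁ hX₂sa.sa hX₂U₂ c2 hg₁ hg₂
      m1 m2 r1 p hp
    refine ⟨F, hF, fun v => ?_⟩
    rw [hFe v v.2, ← hg₁φ v]
    exact hpf (φ v)
  · rintro ⟨p, hp, hpf⟩
    obtain ⟨F, hF, hFe⟩ := half_main hU₂o hU₂sa.sa hU₁o hU₁sa.sa hX₂U₂ hX₁sa.sa hX₁U₁ c1 hg₂ hg₁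
      m2 m1 r2 p hp
    refine ⟨fun v => F v, ⟨F, hF, fun v => rfl⟩, ?_⟩
    funext v
    change F (φ v) = h v
    rw [hFe _ (φ v).2, hg₂φ v, hpf v]
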